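/- Let G be a 5-critical graph on n vertices (χ(G) = 5 and χ(G − v) = 4 for every vertex v). If there exists a set S ⊆ V(G) with |S| ≥ 5 such that the graph G − S obtained by deleting S has chromatic number at least 4, then for every integer y ≥ 4, Q_G(y) ≤ (y+1)·y^{n-4}·(y-1)·(y-2)·(y-3). -/

import Mathlib

/-- The number of proper colourings of `G` with `x` (labelled) colours. -/
noncomputable def numColorings {V : Type} (G : SimpleGraph V) (x : ℕ) : ℕ :=
  Nat.card {f : V → Fin x // ∀ u v : V, G.Adj u v → f u ≠ f v}

/-- `G` is `5`-critical: `χ(G) = 5` and deleting any single vertex yields a graph of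
chromatic number `4`. -/
def FiveCritical {V : Type} (G : SimpleGraph V) : Prop :=
  G.chromaticNumber = 5 ∧ ∀ v : V, (G.induce {u : V | u ≠ v}).chromaticNumber = 4

section

open Finset
open scoped Classical

namespace FiveCrit

variable {V : Type}

/-- `f` is a proper colouring of the subgraph of `G` induced on `W`. -/
def ProperOn {C : Type} (G : SimpleGraph V) (W : Finset V) (f : V → C) : Prop :=
  ∀ u ∈ W, ∀ v ∈ W, G.Adj u v → f u ≠ f v

/-- The subgraph of `G` induced on `W` is `k`-colourable. -/
def Col (k : ℕ) (G : SimpleGraph V) (W : Finset V) : Prop :=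
  ∃ f : V → Fin k, ProperOn G W f

/-- The subgraph of `G` induced on `W` is connected (and nonempty), in terms of cuts. -/
def Conn (G : SimpleGraph V) (W : Finset V) : Prop :=
  W.Nonempty ∧ ∀ S ⊆ W, S.Nonempty → S ≠ W → ∃ u ∈ S, ∃ v ∈ W, v ∉ S ∧ G.Adj u v

theorem ProperOn.mono {C : Type} {G : SimpleGraph V} {W W' : Finset V} {f : V → C}
    (h : ProperOn G W' f) (hW : W ⊆ W') : ProperOn G W f :=
  fun u hu v hv => h u (hW hu) v (hW hv)

theorem Col.mono {k : ℕ} {G : SimpleGraph V} {W W' : Finset V} (h : Col k G W') (hW : W ⊆ W') :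
    Col k G W :=
  h.imp fun _ hf => hf.mono hW

theorem conn_singleton (G : SimpleGraph V) (v : V) : Conn G {v} := by
  refine ⟨singleton_nonempty v, fun S hS hne hS' => ?_⟩
  rcases subset_singleton_iff.1 hS with h | h
  · exact absurd h hne.ne_empty
  · exact absurd h hS'

theorem Conn.insert_adj {G : SimpleGraph V} {W : Finset V} (h : Conn G W) {u v : V} (hu : u ∈ W)
    (huv : G.Adj u v) : Conn G (insert v W) := by
  by_cases hv : v ∈ W
  · rwa [insert_eq_of_mem hv]
  refine ⟨insert_nonempty _ _, fun S hS hne hS' => ?_⟩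
  by_cases h1 : (S ∩ W).Nonempty
  · by_cases h2 : S ∩ W = W
    · have hvS : v ∉ S := fun hvS =>
        hS' (subset_antisymm hS (insert_subset hvS (h2 ▸ inter_subset_left)))
      exact ⟨u, (mem_inter.1 (h2 ▸ hu)).1, v, mem_insert_self _ _, hvS, huv⟩
    · obtain ⟨a, ha, b, hb, hab, hadj⟩ := h.2 _ inter_subset_right h1 h2
      exact ⟨a, (mem_inter.1 ha).1, b, mem_insert_of_mem hb,
        fun hbS => hab (mem_inter.2 ⟨hbS, hb⟩), hadj⟩
  · obtain ⟨s, hs⟩ := hne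
    have key : ∀ t ∈ S, t ∉ W := fun t ht htW => h1 ⟨t, mem_inter.2 ⟨ht, htW⟩⟩
    have hsv : s = v := (mem_insert.1 (hS hs)).resolve_right (key s hs)
    subst hsv
    exact ⟨s, hs, u, mem_insert_of_mem hu, fun huS => key u huS hu, huv.symm⟩

theorem Conn.exists_adj {G : SimpleGraph V} {W T : Finset V} (h : Conn G W) (hT : T ⊆ W)
    (hne : T.Nonempty) (hTW : T ≠ W) : ∃ v ∈ W, v ∉ T ∧ ∃ u ∈ T, G.Adj u v := by
  obtain ⟨u, hu, v, hv, hvT, huv⟩ := h.2 T hT hne hTW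
  exact ⟨v, hv, hvT, u, hu, huv⟩

/-- A connected subset of a connected set grows to connected subsets of all larger sizes. -/
theorem Conn.grow {G : SimpleGraph V} {W T : Finset V} (h : Conn G W) (hT : Conn G T) (hTW : T ⊆ W)
    (k : ℕ) (hk : k ≤ (W \ T).card) :
    ∃ T', T ⊆ T' ∧ T' ⊆ W ∧ Conn G T' ∧ (W \ T').card = k := by
  induction hm : (W \ T).card - k generalizing T with
  | zero => exact ⟨T, subset_rfl, hTW, hT, by omega⟩
  | succ m ih =>
    have hne : T ≠ W := by
      rintro rfl
      simp at hm
    obtain ⟨v, hv, hvT, u, hu, huv⟩ := h.exists_adj hTW hT.1 hne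
    have hc : (W \ insert v T).card + 1 = (W \ T).card := by
      rw [sdiff_insert, card_erase_add_one (mem_sdiff.2 ⟨hv, hvT⟩)]
    obtain ⟨T', h1, h2⟩ := ih (hT.insert_adj hu huv) (insert_subset hv hTW) (by omega) (by omega)
    exact ⟨T', (subset_insert _ _).trans h1, h2⟩

/-- Two proper colourings of a connected set with two colours agree everywhere or nowhere. -/
theorem Conn.two_colorings {G : SimpleGraph V} {W : Finset V} (h : Conn G W) {f g : V → Fin 2}
    (hf : ProperOn G W f) (hg : ProperOn G W g) {u v : V} (hu : u ∈ W) (hv : v ∈ W)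
    (huv : f u = f v) : g u = g v := by
  have key : ∀ a ∈ W, ∀ b ∈ W, G.Adj a b → (f a = g a ↔ f b = g b) := by
    intro a ha b hb hab
    have h1 := hf a ha b hb hab
    have h2 := hg a ha b hb hab
    omega
  have key2 : (f u = g u ↔ f v = g v) := by
    by_contra hcon
    have hst : ∀ x ∈ W, ∀ z ∈ W, f x = g x → ¬ f z = g z → False := by
      intro x hx z hz hfx hfz
      obtain ⟨a, ha, b, hb, hbS, hab⟩ := h.2 (W.filter fun w => f w = g w) (filter_subset _ _)
        ⟨x, mem_filter.2 ⟨hx, hfx⟩⟩ (fun hE => by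
          rw [← hE] at hz
          exact hfz (mem_filter.1 hz).2)
      rw [mem_filter] at ha hbS
      exact hbS ⟨hb, (key a ha.1 b hb hab).1 ha.2⟩
    by_cases h1 : f u = g u
    · exact hcon ⟨fun _ => by_contra fun h2 => hst u hu v hv h1 h2, fun _ => h1⟩
    · exact hcon ⟨fun h2 => absurd h2 h1, fun h2 => (hst v hv u hu h2 h1).elim⟩
  omega

/-! ### Identification of two vertices -/

/-- The map sending `x'` to `x` and fixing every other vertex. -/
noncomputable def fold (x x' : V) (w : V) : V := if w = x' then x else w

theorem fold_self (x x' : V) : fold x x' x' = x := by simp [fold]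

theorem fold_of_ne {x x' w : V} (h : w ≠ x') : fold x x' w = w := by simp [fold, h]

theorem fold_mem {x x' w : V} {W : Finset V} (hx : x ∈ W) (hxx : x ≠ x') (hw : w ∈ W) :
    fold x x' w ∈ W.erase x' := by
  by_cases h : w = x'
  · rw [h, fold_self]; exact mem_erase.2 ⟨hxx, hx⟩
  · rw [fold_of_ne h]; exact mem_erase.2 ⟨h, hw⟩

theorem fold_eq {x x' a b : V} (h : fold x x' a = fold x x' b) (hab : a ≠ b) :
    (a = x ∧ b = x') ∨ (a = x' ∧ b = x) := by
  unfold fold at h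
  split_ifs at h <;> grind

theorem fold_ne_of_adj {G : SimpleGraph V} {x x' a b : V} (hxx : ¬ G.Adj x x') (hab : G.Adj a b) :
    fold x x' a ≠ fold x x' b := by
  intro h
  rcases fold_eq h hab.ne with ⟨rfl, rfl⟩ | ⟨rfl, rfl⟩
  · exact hxx hab
  · exact hxx hab.symm

theorem map_fold_adj {G : SimpleGraph V} {x x' a b : V} (hxx : ¬ G.Adj x x') (hab : G.Adj a b) :
    (G.map (fold x x')).Adj (fold x x' a) (fold x x' b) := by
  rw [SimpleGraph.map_adj']
  exact ⟨fold_ne_of_adj hxx hab, a, b, hab, rfl, rfl⟩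

theorem Conn.conn_fold {G : SimpleGraph V} {W : Finset V} (h : Conn G W) {x x' : V} (hx : x ∈ W)
    (hne : x ≠ x') (hadj : ¬ G.Adj x x') :
    Conn (G.map (fold x x')) (W.erase x') := by
  refine ⟨⟨x, mem_erase.2 ⟨hne, hx⟩⟩, fun S hS hSne hSW => ?_⟩
  obtain ⟨s, hs⟩ := hSne
  have hsW := mem_erase.1 (hS hs)
  obtain ⟨a, ha, b, hb, hbS, hab⟩ := h.2 (W.filter fun w => FiveCrit.fold x x' w ∈ S)
    (filter_subset _ _) ⟨s, by simp [hsW.2, fold_of_ne hsW.1, hs]⟩ (by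
      intro hE
      apply hSW
      refine subset_antisymm hS fun t ht => ?_
      have ht' := mem_erase.1 ht
      have := hE ▸ ht'.2
      rw [mem_filter, fold_of_ne ht'.1] at this
      exact this.2)
  rw [mem_filter] at ha hbS
  exact ⟨_, ha.2, _, fold_mem hx hne hb, fun hc => hbS ⟨hb, hc⟩, map_fold_adj hadj hab⟩

/-- A property of induced subgraphs inherited by supergraphs and by identification of two
nonadjacent vertices. -/
structure HomClosed (P : SimpleGraph V → Finset V → Prop) : Prop where
  mono : ∀ {G W W'}, P G W → W ⊆ W' → P G W'
  fold : ∀ {G W x x'}, P G W → x ∈ W → x' ∈ W → x ≠ x' → ¬ G.Adj x x' →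
    P (G.map (fold x x')) (W.erase x')

theorem homClosed_not_col (k : ℕ) : HomClosed (V := V) fun G W => ¬ Col k G W where
  mono h hW hc := h (hc.mono hW)
  fold := by
    rintro G W x x' h hx hx' hne hadj ⟨f, hf⟩
    exact h ⟨fun w => f (FiveCrit.fold x x' w), fun u hu v hv huv =>
      hf _ (fold_mem hx hne hu) _ (fold_mem hx hne hv) (map_fold_adj hadj huv)⟩

/-- The subgraph induced on `W` contains a triangle. -/
def HasTri (G : SimpleGraph V) (W : Finset V) : Prop :=
  ∃ a ∈ W, ∃ b ∈ W, ∃ c ∈ W, G.Adj a b ∧ G.Adj a c ∧ G.Adj b c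

theorem homClosed_hasTri : HomClosed (V := V) HasTri where
  mono := by
    rintro G W W' ⟨a, ha, b, hb, c, hc, h⟩ hW
    exact ⟨a, hW ha, b, hW hb, c, hW hc, h⟩
  fold := by
    rintro G W x x' ⟨a, ha, b, hb, c, hc, h1, h2, h3⟩ hx hx' hne hadj
    exact ⟨_, fold_mem hx hne ha, _, fold_mem hx hne hb, _, fold_mem hx hne hc,
      map_fold_adj hadj h1, map_fold_adj hadj h2, map_fold_adj hadj h3⟩

/-! ### Colourings of induced subgraphs -/

variable {y : ℕ} {G : SimpleGraph V} {T U W : Finset V}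

/-- The restriction of a colouring to `T`, extended by `0`. -/
noncomputable def restr (T : Finset V) (f : V → Fin (y + 1)) (v : V) : Fin (y + 1) :=
  if v ∈ T then f v else 0

theorem restr_mem {f : V → Fin (y + 1)} {v : V} (h : v ∈ T) : restr T f v = f v := by
  simp [restr, h]

theorem update_inj {x x' : V} (hne : x ≠ x') {f g : V → Fin (y + 1)} (hf : f x = f x')
    (hg : g x = g x') (hE : Function.update f x' 0 = Function.update g x' 0) : f = g := by
  have key : ∀ w, w ≠ x' → f w = g w := by
    intro w hw
    have := congrFun hE w
    simpa [Function.update_of_ne hw] using this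
  funext w
  by_cases h : w = x'
  · rw [h, ← hf, ← hg, key x hne]
  · exact key w h

variable [Fintype V]

/-- The proper colourings of the subgraph induced on `W` with `y + 1` colours, extended by `0`. -/
noncomputable def cols (y : ℕ) (G : SimpleGraph V) (W : Finset V) : Finset (V → Fin (y + 1)) :=
  univ.filter fun f => (∀ v, v ∉ W → f v = 0) ∧ ProperOn G W f

theorem mem_cols {f : V → Fin (y + 1)} :
    f ∈ cols y G W ↔ (∀ v, v ∉ W → f v = 0) ∧ ProperOn G W f := by
  simp [cols]

theorem restr_mem_cols (hT : T ⊆ U) {f : V → Fin (y + 1)} (hf : f ∈ cols y G U) :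
    restr T f ∈ cols y G T := by
  rw [mem_cols] at hf ⊢
  refine ⟨fun v hv => by simp [restr, hv], fun u hu v hv huv => ?_⟩
  rw [restr_mem hu, restr_mem hv]
  exact hf.2 u (hT hu) v (hT hv) huv

/-- Colourings of `U` are counted by colourings of a subset `T` together with a code that
determines the rest. -/
theorem card_cols_le_sum {C : Type} (hT : T ⊆ U) (code : (V → Fin (y + 1)) → C)
    (Z : (V → Fin (y + 1)) → Finset C)
    (hZ : ∀ F ∈ cols y G U, code F ∈ Z (restr T F))
    (hinj : ∀ F ∈ cols y G U, ∀ F' ∈ cols y G U, code F = code F' → ∀ v ∈ U, v ∉ T → F v = F' v) :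
    (cols y G U).card ≤ ∑ f ∈ cols y G T, (Z f).card := by
  rw [← card_sigma]
  refine card_le_card_of_injOn (fun F => ⟨restr T F, code F⟩) (fun F hF => ?_)
    (fun F hF F' hF' hE => ?_)
  · simp only [coe_sigma, Set.mem_sigma_iff, mem_coe]
    exact ⟨restr_mem_cols hT hF, hZ F hF⟩
  · simp only [Sigma.mk.injEq, heq_eq_eq] at hE
    funext v
    by_cases hv : v ∈ T
    · rw [← restr_mem (f := F) hv, hE.1, restr_mem hv]
    · by_cases hvU : v ∈ U
      · exact hinj F hF F' hF' hE.2 v hvU hv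
      · rw [(mem_cols.1 hF).1 v hvU, (mem_cols.1 hF').1 v hvU]

/-- The colours available at `v` relative to a colouring of `T`. -/
noncomputable def avail (G : SimpleGraph V) (T : Finset V) (f : V → Fin (y + 1)) (v : V) :
    Finset (Fin (y + 1)) :=
  univ.filter fun c => ∀ x ∈ T, G.Adj v x → f x ≠ c

theorem mem_avail {F : V → Fin (y + 1)} (hF : F ∈ cols y G U) (hT : T ⊆ U) {v : V} (hv : v ∈ U) :
    F v ∈ avail G T (restr T F) v := by
  simp only [avail, mem_filter, mem_univ, true_and]
  intro x hx hvx
  rw [restr_mem hx]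
  exact (mem_cols.1 hF).2 x (hT hx) v hv hvx.symm

theorem card_avail_le_of_subset {f : V → Fin (y + 1)} {v : V} {X : Finset V} (hX : X ⊆ T)
    (hadj : ∀ x ∈ X, G.Adj v x) : (avail G T f v).card + (X.image f).card ≤ y + 1 := by
  rw [← card_union_of_disjoint]
  · simpa using card_le_univ (avail G T f v ∪ X.image f)
  · rw [disjoint_left]
    intro c hc hc'
    obtain ⟨x, hx, rfl⟩ := mem_image.1 hc'
    simp only [avail, mem_filter, mem_univ, true_and] at hc
    exact hc x (hX hx) (hadj x hx) rfl

theorem card_avail_le_one {f : V → Fin (y + 1)} {v x : V} (hx : x ∈ T) (hadj : G.Adj v x) :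
    (avail G T f v).card ≤ y := by
  have := card_avail_le_of_subset (f := f) (X := {x}) (by simpa using hx) (by simpa using hadj)
  simp at this
  exact this

theorem card_cols_insert_le {u v : V} (hu : u ∈ T) (huv : G.Adj u v) :
    (cols y G (insert v T)).card ≤ (cols y G T).card * y := by
  refine (card_cols_le_sum (subset_insert v T) (fun F => F v) (fun f => avail G T f v)
    (fun F hF => mem_avail hF (subset_insert v T) (mem_insert_self v T)) ?_).trans ?_
  · intro F _ F' _ hE w hw hwT
    rw [(mem_insert.1 hw).resolve_right hwT]
    exact hE
  · exact sum_le_card_nsmul _ _ _ fun f _ => card_avail_le_one hu huv.symm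

theorem card_cols_le_of_conn (hW : Conn G W) (hUW : U ⊆ W) (hU : U.Nonempty) :
    (cols y G W).card ≤ (cols y G U).card * y ^ (W \ U).card := by
  induction hm : (W \ U).card generalizing U with
  | zero =>
    rw [card_eq_zero, sdiff_eq_empty_iff_subset] at hm
    simp [subset_antisymm hUW hm]
  | succ m ih =>
    have hne : U ≠ W := by
      rintro rfl
      simp at hm
    obtain ⟨v, hv, hvU, u, hu, huv⟩ := hW.exists_adj hUW hU hne
    have hc : (W \ insert v U).card + 1 = (W \ U).card := by
      rw [sdiff_insert, card_erase_add_one (mem_sdiff.2 ⟨hv, hvU⟩)]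
    calc (cols y G W).card ≤ (cols y G (insert v U)).card * y ^ m :=
          ih (insert_subset hv hUW) (insert_nonempty _ _) (by omega)
      _ ≤ (cols y G U).card * y * y ^ m := Nat.mul_le_mul_right _ (card_cols_insert_le hu huv)
      _ = _ := by ring

theorem card_cols_empty : (cols y G ∅).card ≤ 1 := by
  refine card_le_one.2 fun f hf g hg => ?_
  rw [mem_cols] at hf hg
  funext v
  rw [hf.1 v (by simp), hg.1 v (by simp)]

theorem card_cols_singleton (v : V) : (cols y G {v}).card ≤ y + 1 := by
  refine (card_cols_le_sum (empty_subset {v}) (fun F => F v) (fun _ => univ)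
    (fun F _ => mem_univ _) ?_).trans ?_
  · intro F _ F' _ hE w hw _
    rw [mem_singleton.1 hw]
    exact hE
  · have := card_cols_empty (y := y) (G := G)
    simp only [card_univ, Fintype.card_fin, sum_const, smul_eq_mul]
    nlinarith

theorem card_cols_le_pow (hW : Conn G W) : (cols y G W).card ≤ (y + 1) * y ^ (W.card - 1) := by
  obtain ⟨v, hv⟩ := hW.1
  refine (card_cols_le_of_conn hW (singleton_subset_iff.2 hv) (singleton_nonempty v)).trans ?_
  rw [card_sdiff_of_subset (singleton_subset_iff.2 hv), card_singleton]
  exact Nat.mul_le_mul_right _ (card_cols_singleton v)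

theorem update_mem_cols {x x' : V} (hx' : x' ∈ W) {f : V → Fin (y + 1)} (hf : f ∈ cols y G W)
    (hxx : f x = f x') : Function.update f x' 0 ∈ cols y (G.map (fold x x')) (W.erase x') := by
  rw [mem_cols] at hf ⊢
  have hfold : ∀ w, f (FiveCrit.fold x x' w) = f w := by
    intro w
    unfold FiveCrit.fold
    split_ifs with h
    · rw [h, hxx]
    · rfl
  refine ⟨fun v hv => ?_, fun u hu v hv huv => ?_⟩
  · by_cases h : v = x'
    · simp [h]
    · rw [Function.update_of_ne h]
      exact hf.1 v fun hvW => hv (mem_erase.2 ⟨h, hvW⟩)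
  · rw [mem_erase] at hu hv
    rw [Function.update_of_ne hu.1, Function.update_of_ne hv.1]
    rw [SimpleGraph.map_adj'] at huv
    obtain ⟨-, a, b, hab, rfl, rfl⟩ := huv
    rw [hfold, hfold]
    have hmem : ∀ {w}, FiveCrit.fold x x' w ∈ W → w ∈ W := by
      intro w hw
      by_cases h : w = x'
      · rwa [h]
      · rwa [fold_of_ne h] at hw
    exact hf.2 a (hmem hu.2) b (hmem hv.2) hab

theorem card_cols_eq_le {x x' : V} (hx' : x' ∈ W) (hne : x ≠ x') :
    ((cols y G W).filter fun f => f x = f x').card ≤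
      ((cols y (G.map (fold x x')) (W.erase x'))).card := by
  refine card_le_card_of_injOn (fun f => Function.update f x' 0) (fun f hf => ?_)
    (fun f hf g hg hE => ?_) <;> simp only [coe_filter, Set.mem_ofPred_eq] at hf
  · exact update_mem_cols hx' hf.1 hf.2
  · simp only [coe_filter, Set.mem_ofPred_eq] at hg
    exact update_inj hne hf.2 hg.2 hE

end FiveCrit

namespace FiveCrit

variable {V : Type}

variable {y : ℕ} {G : SimpleGraph V} {T U W : Finset V}

/-! ### Critical sets -/

/-- `W` induces a vertex-critical subgraph that is not `k`-colourable. -/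
def Crit (k : ℕ) (G : SimpleGraph V) (W : Finset V) : Prop :=
  ¬ Col k G W ∧ ∀ v ∈ W, Col k G (W.erase v)

theorem exists_crit {k : ℕ} (h : ¬ Col k G W) : ∃ U ⊆ W, Crit k G U := by
  obtain ⟨U, hU, hmin⟩ := exists_min_image (W.powerset.filter fun U => ¬ Col k G U) card
    ⟨W, by simp [h]⟩
  rw [mem_filter, mem_powerset] at hU
  refine ⟨U, hU.1, hU.2, fun v hv => by_contra fun hc => ?_⟩
  have := hmin (U.erase v) (mem_filter.2 ⟨mem_powerset.2 ((erase_subset _ _).trans hU.1), hc⟩)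
  have := card_erase_lt_of_mem hv
  omega

variable {k : ℕ}

theorem Crit.nonempty [NeZero k] (h : Crit k G W) : W.Nonempty := by
  rw [nonempty_iff_ne_empty]
  rintro rfl
  exact h.1 ⟨fun _ => 0, by simp [ProperOn]⟩

theorem Crit.conn [NeZero k] (h : Crit k G W) : Conn G W := by
  refine ⟨h.nonempty, fun S hS hne hSW => ?_⟩
  by_contra! hcon
  obtain ⟨s, hs⟩ := hne
  obtain ⟨t, ht, htS⟩ := exists_of_ssubset (hS.ssubset_of_ne hSW)
  obtain ⟨f, hf⟩ := h.2 t ht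
  obtain ⟨g, hg⟩ := h.2 s (hS hs)
  refine h.1 ⟨fun v => if v ∈ S then f v else g v, fun u hu v hv huv => ?_⟩
  have hf' : ∀ w ∈ S, w ∈ W.erase t := fun w hw => mem_erase.2 ⟨fun h => htS (h ▸ hw), hS hw⟩
  have hg' : ∀ w ∈ W, w ∉ S → w ∈ W.erase s := fun w hw hwS =>
    mem_erase.2 ⟨fun h => hwS (h ▸ hs), hw⟩
  by_cases huS : u ∈ S <;> by_cases hvS : v ∈ S
  · simpa [huS, hvS] using hf u (hf' u huS) v (hf' v hvS) huv
  · exact absurd huv (hcon u huS v hv hvS)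
  · exact absurd huv.symm (hcon v hvS u hu huS)
  · simpa [huS, hvS] using hg u (hg' u hu huS) v (hg' v hv hvS) huv

theorem Crit.extend (h : Crit k G W) {v : V} (hv : v ∈ W) {f : V → Fin k}
    (hf : ProperOn G (W.erase v) f) (c : Fin k) : ∃ u ∈ W, G.Adj v u ∧ f u = c := by
  by_contra! hcon
  refine h.1 ⟨Function.update f v c, fun u hu w hw huw => ?_⟩
  by_cases huv : u = v
  · subst huv
    rw [Function.update_self, Function.update_of_ne huw.ne']
    exact (hcon w hw huw).symm
  · by_cases hwv : w = v
    · subst hwv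
      rw [Function.update_self, Function.update_of_ne huw.ne]
      exact hcon u hu huw.symm
    · rw [Function.update_of_ne huv, Function.update_of_ne hwv]
      exact hf u (mem_erase.2 ⟨huv, hu⟩) w (mem_erase.2 ⟨hwv, hw⟩) huw

theorem Crit.le_degree (h : Crit k G W) {v : V} (hv : v ∈ W) :
    k ≤ (W.filter fun u => G.Adj v u).card := by
  obtain ⟨f, hf⟩ := h.2 v hv
  have : (univ : Finset (Fin k)) ⊆ (W.filter fun u => G.Adj v u).image f := by
    intro c _
    obtain ⟨u, hu, hvu, hc⟩ := h.extend hv hf c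
    exact mem_image.2 ⟨u, mem_filter.2 ⟨hu, hvu⟩, hc⟩
  simpa using (card_le_card this).trans card_image_le

theorem Crit.exists_not_adj (h : Crit k G W) {u v : V} (hu : u ∈ W) (hv : v ∈ W) (hne : u ≠ v) :
    ∃ w ∈ W, G.Adj u w ∧ ¬ G.Adj v w := by
  by_contra! hcon
  obtain ⟨f, hf⟩ := h.2 u hu
  obtain ⟨w, hw, huw, hfw⟩ := h.extend hu hf (f v)
  exact hf v (mem_erase.2 ⟨hne.symm, hv⟩) w (mem_erase.2 ⟨huw.ne', hw⟩) (hcon w hw huw) hfw.symm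

/-! ### Counting colourings with coincidences -/

variable [Fintype V]

/-- Upper bounds for the number of colourings of `T`, and for the numbers of colourings in which
one or two given pairs of vertices receive equal colours. -/
structure Spread (y : ℕ) (G : SimpleGraph V) (T : Finset V) (K : ℝ) : Prop where
  total : ((cols y G T).card : ℝ) ≤ K
  pair : ∀ x ∈ T, ∀ x' ∈ T, x ≠ x' →
    (((cols y G T).filter fun f => f x = f x').card : ℝ) * y ≤ K
  two : ∀ x ∈ T, ∀ x' ∈ T, ∀ z ∈ T, ∀ z' ∈ T, x ≠ x' → z ≠ z' → s(x, x') ≠ s(z, z') →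
    (((cols y G T).filter fun f => f x = f x' ∧ f z = f z').card : ℝ) * y ^ 2 ≤ K

/-- Connected subgraphs with property `P` have at most `κ y ^ m` colourings, `m` being their
number of vertices. -/
def Good (V : Type) [Fintype V] (y : ℕ) (κ : ℝ) (P : SimpleGraph V → Finset V → Prop) : Prop :=
  ∀ G W, Conn G W → P G W → ((cols y G W).card : ℝ) ≤ κ * y ^ W.card

variable {κ : ℝ} {P : SimpleGraph V → Finset V → Prop}

theorem filter_eq_of_adj {x x' : V} (hx : x ∈ T) (hx' : x' ∈ T) (h : G.Adj x x') :
    ((cols y G T).filter fun f => f x = f x') = ∅ :=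
  filter_eq_empty_iff.2 fun _ hf => (mem_cols.1 hf).2 x hx x' hx' h

theorem Good.pair (hgood : Good V y κ P) (hP : HomClosed P) (hκ : 0 ≤ κ) (hT : Conn G T)
    (hPT : P G T) {x x' : V} (hx : x ∈ T) (hx' : x' ∈ T) (hne : x ≠ x') :
    (((cols y G T).filter fun f => f x = f x').card : ℝ) * y ≤ κ * y ^ T.card := by
  by_cases h : G.Adj x x'
  · rw [filter_eq_of_adj hx hx' h]
    simp only [card_empty, Nat.cast_zero, zero_mul]
    positivity
  · have h1 := hgood _ _ (hT.conn_fold hx hne h) (hP.fold hPT hx hx' hne h)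
    have h2 : (((cols y G T).filter fun f => f x = f x').card : ℝ) ≤ _ :=
      Nat.cast_le.2 (card_cols_eq_le (y := y) (G := G) hx' hne)
    have h3 : T.card = (T.erase x').card + 1 := (card_erase_add_one hx').symm
    rw [h3, pow_succ, ← mul_assoc]
    exact mul_le_mul_of_nonneg_right (h2.trans h1) (Nat.cast_nonneg _)

theorem Good.two (hgood : Good V y κ P) (hP : HomClosed P) (hκ : 0 ≤ κ) (hT : Conn G T)
    (hPT : P G T) {x x' z z' : V} (hx : x ∈ T) (hx' : x' ∈ T) (hz : z ∈ T) (hz' : z' ∈ T)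
    (hne : x ≠ x') (hzne : z ≠ z') (hs : s(x, x') ≠ s(z, z')) :
    (((cols y G T).filter fun f => f x = f x' ∧ f z = f z').card : ℝ) * y ^ 2 ≤
      κ * y ^ T.card := by
  by_cases h : G.Adj x x'
  · rw [← filter_filter, filter_eq_of_adj hx hx' h]
    simp only [filter_empty, card_empty, Nat.cast_zero, zero_mul]
    positivity
  · have hfne : fold x x' z ≠ fold x x' z' := by
      intro hE
      rcases fold_eq hE hzne with ⟨rfl, rfl⟩ | ⟨rfl, rfl⟩
      · exact hs rfl
      · exact hs Sym2.eq_swap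
    have h1 := hgood.pair hP hκ (hT.conn_fold hx hne h) (hP.fold hPT hx hx' hne h)
      (fold_mem hx hne hz) (fold_mem hx hne hz') hfne
    have h2 : ((cols y G T).filter fun f => f x = f x' ∧ f z = f z').card ≤
        ((cols y (G.map (fold x x')) (T.erase x')).filter
          fun f => f (fold x x' z) = f (fold x x' z')).card := by
      refine card_le_card_of_injOn (fun f => Function.update f x' 0) (fun f hf => ?_)
        (fun f hf g hg hE => ?_)
      · simp only [coe_filter, Set.mem_ofPred_eq] at hf ⊢
        refine ⟨update_mem_cols hx' hf.1 hf.2.1, ?_⟩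
        have key : ∀ w, Function.update f x' 0 (fold x x' w) = f w := by
          intro w
          by_cases hw : w = x'
          · rw [hw, fold_self, Function.update_of_ne hne, hf.2.1]
          · rw [fold_of_ne hw, Function.update_of_ne hw]
        rw [key, key]
        exact hf.2.2
      · simp only [coe_filter, Set.mem_ofPred_eq] at hf hg
        exact update_inj hne hf.2.1 hg.2.1 hE
    have h3 : T.card = (T.erase x').card + 1 := (card_erase_add_one hx').symm
    have h2' := Nat.cast_le (α := ℝ).2 h2
    rw [h3, pow_succ (y : ℝ) (T.erase x').card, ← mul_assoc, sq, ← mul_assoc]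
    exact mul_le_mul_of_nonneg_right
      ((mul_le_mul_of_nonneg_right h2' (Nat.cast_nonneg _)).trans h1) (Nat.cast_nonneg _)

theorem Good.spread (hgood : Good V y κ P) (hP : HomClosed P) (hκ : 0 ≤ κ) (hT : Conn G T)
    (hPT : P G T) : Spread y G T (κ * y ^ T.card) where
  total := hgood G T hT hPT
  pair _ hx _ hx' hne := hgood.pair hP hκ hT hPT hx hx' hne
  two _ hx _ hx' _ hz _ hz' hne hzne hs := hgood.two hP hκ hT hPT hx hx' hz hz' hne hzne hs

theorem Spread.nonneg {K : ℝ} (h : Spread y G T K) : 0 ≤ K := (Nat.cast_nonneg _).trans h.total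

/-! ### Graphs that are not bipartite -/

theorem good_not_col_two (hy : 1 ≤ y) : Good V y 1 fun G W => ¬ Col 2 G W := by
  intro G W hW hcol
  rw [one_mul]
  induction hm : W.card using Nat.strong_induction_on generalizing G W with
  | _ m ih =>
    have hcard : 1 < W.card := by
      by_contra! hc
      refine hcol ⟨fun _ => 0, fun u hu v hv huv => ?_⟩
      exact absurd (card_le_one.1 hc u hu v hv) huv.ne
    obtain ⟨w₀, hw₀⟩ := hW.1
    obtain ⟨T, -, hTW, hT, hc⟩ := hW.grow (conn_singleton G w₀) (singleton_subset_iff.2 hw₀) 1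
      (by rw [card_sdiff_of_subset (singleton_subset_iff.2 hw₀), card_singleton]; omega)
    obtain ⟨v, hv⟩ := card_eq_one.1 hc
    have hvm : v ∈ W \ T := hv ▸ mem_singleton_self v
    rw [mem_sdiff] at hvm
    have hWT : W = insert v T := by
      rw [← sdiff_union_of_subset hTW, hv]; rfl
    have hTc : T.card + 1 = m := by rw [← hm, hWT, card_insert_of_notMem hvm.2]
    obtain ⟨m, rfl⟩ : ∃ m', m = m' + 1 := ⟨_, hTc.symm⟩
    obtain ⟨u, hu, huv⟩ : ∃ u ∈ T, G.Adj u v := by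
      obtain ⟨a, ha, haT, u, hu, hua⟩ := hW.exists_adj hTW hT.1 (fun h => hvm.2 (h ▸ hvm.1))
      rw [hWT] at ha
      rw [(mem_insert.1 ha).resolve_right haT] at hua
      exact ⟨u, hu, hua⟩
    by_cases hTcol : Col 2 G T
    · obtain ⟨g, hg⟩ := hTcol
      obtain ⟨u', hu', hu'v, hgu⟩ : ∃ u' ∈ T, G.Adj u' v ∧ g u ≠ g u' := by
        by_contra! hcon
        refine hcol ⟨Function.update g v (g u + 1), fun a ha b hb hab => ?_⟩
        rw [hWT, mem_insert] at ha hb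
        have hgne : ∀ c : Fin 2, c + 1 ≠ c := by decide
        rcases ha with rfl | ha
        · have hb' := hb.resolve_left hab.ne'
          rw [Function.update_self, Function.update_of_ne hab.ne', ← hcon b hb' hab.symm]
          exact hgne _
        · have hav : a ≠ v := fun h => hvm.2 (h ▸ ha)
          rcases hb with rfl | hb
          · rw [Function.update_self, Function.update_of_ne hav, ← hcon a ha hab]
            exact (hgne _).symm
          · have hbv : b ≠ v := fun h => hvm.2 (h ▸ hb)
            rw [Function.update_of_ne hav, Function.update_of_ne hbv]
            exact hg a ha b hb hab
      have hne : u ≠ u' := fun h => hgu (h ▸ rfl)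
      have h1 : (cols y G W).card ≤
          ∑ f ∈ cols y G T, ((y - 1) + if f u = f u' then 1 else 0) := by
        refine (card_cols_le_sum (hWT ▸ subset_insert v T) (fun F => F v) (fun f => avail G T f v)
          (fun F hF => mem_avail hF hTW hvm.1) ?_).trans (sum_le_sum fun f _ => ?_)
        · intro F _ F' _ hE w hw hwT
          rw [hWT] at hw
          rw [(mem_insert.1 hw).resolve_right hwT]
          exact hE
        · split_ifs with hf
          · have := card_avail_le_one (f := f) hu huv.symm
            omega
          · have := card_avail_le_of_subset (f := f) (v := v) (G := G) (T := T) (X := {u, u'})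
              (by simp [insert_subset_iff, hu, hu']) (by simp [huv.symm, hu'v.symm])
            rw [image_insert, image_singleton, card_pair hf] at this
            omega
      rw [sum_add_distrib, sum_const, smul_eq_mul, sum_boole] at h1
      have h2 : (((cols y G T).filter fun f => f u = f u').card : ℝ) * y ≤ (y : ℝ) ^ m := by
        by_cases hadj : G.Adj u u'
        · rw [filter_eq_of_adj hu hu' hadj]
          simp
        · have h3 := ih (T.erase u').card (by rw [← card_erase_add_one hu'] at hTc; omega)
            (G.map (fold u u')) (T.erase u') (hT.conn_fold hu hne hadj) (by
              rintro ⟨f, hf⟩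
              refine hgu (hT.two_colorings (f := fun w => f (fold u u' w)) (fun a ha b hb hab => ?_)
                hg hu hu' (by simp [fold_self, fold_of_ne hne]))
              exact hf _ (fold_mem hu hne ha) _ (fold_mem hu hne hb) (map_fold_adj hadj hab)) rfl
          have h4 : (((cols y G T).filter fun f => f u = f u').card : ℝ) ≤ _ :=
            Nat.cast_le.2 (card_cols_eq_le (y := y) (G := G) hu' hne)
          have h5 : m = (T.erase u').card + 1 := by rw [card_erase_add_one hu']; omega
          rw [h5, pow_succ]
          exact mul_le_mul_of_nonneg_right (h4.trans h3) (Nat.cast_nonneg _)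
      have h6 : ((cols y G T).card : ℝ) * y ≤ (y + 1) * y ^ m := by
        have := card_cols_le_pow (y := y) hT
        have h7 : ((cols y G T).card : ℝ) ≤ (y + 1) * y ^ (T.card - 1) := by exact_mod_cast this
        obtain ⟨t, ht⟩ : ∃ t, T.card = t + 1 := ⟨T.card - 1, by have := hT.1.card_pos; omega⟩
        have : m = t + 1 := by omega
        rw [ht] at h7
        rw [this, pow_succ, ← mul_assoc]
        exact mul_le_mul_of_nonneg_right h7 (Nat.cast_nonneg _)
      have hy' : (1 : ℝ) ≤ y := by exact_mod_cast hy
      have h8 : ((cols y G W).card : ℝ) ≤ (cols y G T).card * (y - 1) +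
          ((cols y G T).filter fun f => f u = f u').card := by
        have := Nat.cast_le (α := ℝ).2 h1
        push_cast [Nat.cast_sub hy] at this
        exact this
      have hpos : (0 : ℝ) < y := by linarith
      refine le_of_mul_le_mul_right ?_ hpos
      have h9 := mul_le_mul_of_nonneg_right h8 hpos.le
      have h10 := mul_le_mul_of_nonneg_right h6 (sub_nonneg.2 hy')
      refine h9.trans ?_
      rw [pow_succ]
      nlinarith
    · have h1 := ih m (by omega) G T hT hTcol (by omega)
      have h2 : ((cols y G W).card : ℝ) ≤ (cols y G T).card * y := by
        rw [hWT]
        exact_mod_cast card_cols_insert_le hu huv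
      refine h2.trans ?_
      rw [pow_succ]
      exact mul_le_mul_of_nonneg_right h1 (Nat.cast_nonneg _)

/-! ### Graphs with a triangle -/

theorem good_hasTri (hy : 1 ≤ y) : Good V y (((y : ℝ) ^ 2 - 1) / y ^ 2) HasTri := by
  rintro G W hW ⟨a, ha, b, hb, c, hc, hab, hac, hbc⟩
  have hsub : ({c, b, a} : Finset V) ⊆ W := by simp [insert_subset_iff, ha, hb, hc]
  have h1 := card_cols_le_of_conn (y := y) hW hsub ⟨c, by simp⟩
  have h2 : (cols y G {c, b, a}).card ≤ (cols y G {b, a}).card * (y - 1) := by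
    refine (card_cols_le_sum (T := {b, a}) (subset_insert _ _) (fun F => F c)
      (fun f => avail G {b, a} f c)
      (fun F hF => mem_avail hF (subset_insert _ _) (mem_insert_self _ _)) ?_).trans
      (sum_le_card_nsmul _ _ _ fun f hf => ?_)
    · intro F _ F' _ hE w hw hwT
      rw [(mem_insert.1 hw).resolve_right hwT]
      exact hE
    · have := card_avail_le_of_subset (f := f) (v := c) (G := G) (T := {b, a}) (X := {b, a})
        subset_rfl (by simp [hbc.symm, hac.symm])
      rw [image_insert, image_singleton, card_pair] at this
      · omega
      · exact (mem_cols.1 hf).2 b (by simp) a (by simp) hab.symm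
  have h3 : (cols y G {b, a}).card ≤ (cols y G {a}).card * y :=
    card_cols_insert_le (mem_singleton_self a) hab
  have h4 := card_cols_singleton (y := y) (G := G) a
  have hcard : ({c, b, a} : Finset V).card = 3 := by
    rw [card_eq_three]
    exact ⟨c, b, a, hbc.ne', hac.ne', hab.ne', rfl⟩
  have hW3 : W.card = (W \ {c, b, a}).card + 3 := by
    rw [card_sdiff_of_subset hsub, hcard]
    have := card_le_card hsub
    omega
  have h5 : (cols y G W).card ≤ (y + 1) * y * (y - 1) * y ^ (W \ {c, b, a}).card :=
    h1.trans (Nat.mul_le_mul_right _ (h2.trans (Nat.mul_le_mul_right _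
      (h3.trans (Nat.mul_le_mul_right _ h4)))))
  have h6 : ((cols y G W).card : ℝ) ≤ (y + 1) * y * (y - 1) * y ^ (W \ {c, b, a}).card := by
    have := Nat.cast_le (α := ℝ).2 h5
    push_cast [Nat.cast_sub hy] at this
    exact this
  refine h6.trans (le_of_eq ?_)
  have : (y : ℝ) ≠ 0 := by positivity
  rw [hW3]
  field_simp
  ring

end FiveCrit

namespace FiveCrit

/-! ### Counting tuples of distinct colours from lists -/

section Lists

variable {y : ℕ}

/-- Pairs of distinct colours from two lists. -/
def edgeSet (A B : Finset (Fin (y + 1))) : Finset (Fin (y + 1) × Fin (y + 1)) :=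
  (A ×ˢ B).filter fun p => p.1 ≠ p.2

/-- Triples of distinct colours from three lists. -/
def triSet (A B C : Finset (Fin (y + 1))) : Finset (Fin (y + 1) × Fin (y + 1) × Fin (y + 1)) :=
  (A ×ˢ B ×ˢ C).filter fun p => p.1 ≠ p.2.1 ∧ p.1 ≠ p.2.2 ∧ p.2.1 ≠ p.2.2

theorem exists_superset_of_card_le {A : Finset (Fin (y + 1))} {m : ℕ} (h : A.card ≤ m)
    (hm : m ≤ y + 1) : ∃ A', A ⊆ A' ∧ A'.card = m :=
  Finset.exists_superset_card_eq h (by simpa using hm)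

theorem card_inter_ge (A B : Finset (Fin (y + 1))) :
    (A.card + B.card : ℝ) - (y + 1) ≤ (A ∩ B).card := by
  have h1 := card_union_add_card_inter A B
  have h2 : (A ∪ B).card ≤ y + 1 := by simpa using card_le_univ (A ∪ B)
  have h3 : A.card + B.card ≤ (A ∩ B).card + (y + 1) := by omega
  have h4 : (A.card + B.card : ℝ) ≤ (A ∩ B).card + (y + 1) := by exact_mod_cast h3
  linarith

theorem card_edgeSet (A B : Finset (Fin (y + 1))) :
    ((edgeSet A B).card : ℝ) = A.card * B.card - (A ∩ B).card := by
  have h : ((A ×ˢ B).filter fun p => ¬ p.1 ≠ p.2).card = (A ∩ B).card := by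
    rw [← card_image_of_injOn (s := A ∩ B) (f := fun c => (c, c))
      (fun a _ b _ h => by simpa using h)]
    congr 1
    ext ⟨a, b⟩
    simp only [mem_filter, mem_product, mem_image, mem_inter, Prod.mk.injEq]
    grind
  have h2 := card_filter_add_card_filter_not (s := A ×ˢ B) fun p => p.1 ≠ p.2
  rw [h, card_product] at h2
  rw [eq_sub_iff_add_eq]
  exact_mod_cast h2

theorem card_edgeSet_le {A B : Finset (Fin (y + 1))} {a b : ℕ} (hA : A.card ≤ a)
    (hB : B.card ≤ b) (ha : 1 ≤ a) (hb : 1 ≤ b) :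
    ((edgeSet A B).card : ℝ) ≤ (a - 1) * (b - 1) + y := by
  have ha' : (1 : ℝ) ≤ a := by exact_mod_cast ha
  have hb' : (1 : ℝ) ≤ b := by exact_mod_cast hb
  have hA' : (A.card : ℝ) ≤ a := by exact_mod_cast hA
  have hB' : (B.card : ℝ) ≤ b := by exact_mod_cast hB
  have hy : (0 : ℝ) ≤ y := Nat.cast_nonneg _
  have hE : 0 ≤ ((a : ℝ) - 1) * (b - 1) + y := by
    have := mul_nonneg (sub_nonneg.2 ha') (sub_nonneg.2 hb')
    linarith
  rcases A.eq_empty_or_nonempty with rfl | hAne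
  · simpa [edgeSet] using hE
  rcases B.eq_empty_or_nonempty with rfl | hBne
  · simpa [edgeSet] using hE
  have h1 : (1 : ℝ) ≤ A.card := by exact_mod_cast hAne.card_pos
  have h2 : (1 : ℝ) ≤ B.card := by exact_mod_cast hBne.card_pos
  have h3 := card_inter_ge A B
  rw [card_edgeSet]
  have := mul_le_mul (sub_le_sub_right hA' 1) (sub_le_sub_right hB' 1) (sub_nonneg.2 h2)
    (sub_nonneg.2 ha')
  linarith

theorem card_triSet (A B C : Finset (Fin (y + 1))) :
    ((triSet A B C).card : ℝ) = A.card * B.card * C.card - (A ∩ B).card * C.card -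
      (A ∩ C).card * B.card - (B ∩ C).card * A.card + 2 * (A ∩ B ∩ C).card := by
  let χ : Finset (Fin (y + 1)) → Fin (y + 1) → ℝ := fun X a => if a ∈ X then 1 else 0
  have hχ : ∀ X Y : Finset (Fin (y + 1)), ∑ a ∈ X, χ Y a = (X ∩ Y).card := by
    intro X Y
    rw [sum_boole, filter_mem_eq_inter]
  have hδ : ∀ (X : Finset (Fin (y + 1))) (a : Fin (y + 1)),
      ∑ b ∈ X, (if a = b then (1 : ℝ) else 0) = χ X a := by
    intro X a
    rw [sum_ite_eq]
  have h1 : ((triSet A B C).card : ℝ) = ∑ a ∈ A, ∑ b ∈ B, ∑ c ∈ C,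
      (1 - (if a = b then 1 else 0) - (if a = c then 1 else 0) - (if b = c then 1 else 0) +
        2 * (if a = b then 1 else 0) * (if a = c then 1 else 0) : ℝ) := by
    rw [triSet, card_filter, sum_product, Nat.cast_sum]
    refine sum_congr rfl fun a _ => ?_
    rw [sum_product, Nat.cast_sum]
    refine sum_congr rfl fun b _ => ?_
    rw [Nat.cast_sum]
    refine sum_congr rfl fun c _ => ?_
    by_cases hab : a = b
    · subst hab
      by_cases hac : a = c <;> simp [hac]
      norm_num
    · by_cases hac : a = c
      · subst hac
        simp [hab, Ne.symm hab]
      · by_cases hbc : b = c <;> simp [hab, hac, hbc]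
  have h2 : ∀ a, ∑ b ∈ B, (if a = b then (1 : ℝ) else 0) * χ C a = χ B a * χ C a := by
    intro a
    rw [← sum_mul, hδ]
  have h3 : ∑ a ∈ A, χ B a * χ C a = (A ∩ B ∩ C).card := by
    rw [inter_assoc, ← hχ]
    refine sum_congr rfl fun a _ => ?_
    simp only [χ, mem_inter, ite_and]
    split_ifs <;> simp
  rw [h1]
  simp only [sum_add_distrib, sum_sub_distrib, ← mul_sum, sum_const, nsmul_eq_mul, mul_one, hδ, hχ,
    mul_assoc, h2, h3]
  ring

/-- The number of triples of distinct colours from three lists with minimal overlaps. -/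
def triBound (y a b c : ℝ) : ℝ :=
  a * b * c - (a + b - (y + 1)) * c - (a + c - (y + 1)) * b - (b + c - (y + 1)) * a +
    2 * (a + b + c - 2 * (y + 1))

theorem card_triSet_le {A B C : Finset (Fin (y + 1))} {a b c : ℕ} (hA : A.card ≤ a)
    (hB : B.card ≤ b) (hC : C.card ≤ c) (ha : a ≤ y + 1) (hb : b ≤ y + 1) (hc : c ≤ y + 1)
    (ha2 : 2 ≤ a) (hb2 : 2 ≤ b) (hc2 : 2 ≤ c) :
    ((triSet A B C).card : ℝ) ≤ triBound y a b c := by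
  obtain ⟨A', hAA, rfl⟩ := exists_superset_of_card_le hA ha
  obtain ⟨B', hBB, rfl⟩ := exists_superset_of_card_le hB hb
  obtain ⟨C', hCC, rfl⟩ := exists_superset_of_card_le hC hc
  have hmono : triSet A B C ⊆ triSet A' B' C' :=
    filter_subset_filter _ (product_subset_product hAA (product_subset_product hBB hCC))
  have h1 : ((triSet A B C).card : ℝ) ≤ (triSet A' B' C').card := by
    exact_mod_cast card_le_card hmono
  refine h1.trans ?_
  rw [card_triSet]
  have hu : (A' ∩ B' ∩ C').card + A'.card + B'.card + C'.card ≤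
      (y + 1) + (A' ∩ B').card + (A' ∩ C').card + (B' ∩ C').card := by
    have e1 := card_union_add_card_inter A' B'
    have e2 := card_union_add_card_inter (A' ∪ B') C'
    have e3 := card_union_add_card_inter (A' ∩ C') (B' ∩ C')
    have e4 : (A' ∪ B') ∩ C' = (A' ∩ C') ∪ (B' ∩ C') := union_inter_distrib_right _ _ _
    have e5 : (A' ∩ C') ∩ (B' ∩ C') = A' ∩ B' ∩ C' := by ext; simp
    have e6 : (A' ∪ B' ∪ C').card ≤ y + 1 := by simpa using card_le_univ (A' ∪ B' ∪ C')
    rw [e4] at e2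
    rw [e5] at e3
    omega
  have hu' : ((A' ∩ B' ∩ C').card + A'.card + B'.card + C'.card : ℝ) ≤
      (y + 1) + (A' ∩ B').card + (A' ∩ C').card + (B' ∩ C').card := by exact_mod_cast hu
  have n1 := card_inter_ge A' B'
  have n2 := card_inter_ge A' C'
  have n3 := card_inter_ge B' C'
  have ha2' : (2 : ℝ) ≤ A'.card := by exact_mod_cast ha2
  have hb2' : (2 : ℝ) ≤ B'.card := by exact_mod_cast hb2
  have hc2' : (2 : ℝ) ≤ C'.card := by exact_mod_cast hc2
  have p1 := mul_nonneg (sub_nonneg.2 n1) (sub_nonneg.2 hc2')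
  have p2 := mul_nonneg (sub_nonneg.2 n2) (sub_nonneg.2 hb2')
  have p3 := mul_nonneg (sub_nonneg.2 n3) (sub_nonneg.2 ha2')
  unfold triBound
  nlinarith

/-- A chord bound for `triBound` when the lists have size `y - 1` or `y`. -/
theorem triBound_le (hy : 4 ≤ y) {e₁ e₂ e₃ : ℝ} (h₁ : e₁ = 0 ∨ e₁ = 1) (h₂ : e₂ = 0 ∨ e₂ = 1)
    (h₃ : e₃ = 0 ∨ e₃ = 1) :
    triBound y (y - 1 + e₁) (y - 1 + e₂) (y - 1 + e₃) ≤ triBound y (y - 1) (y - 1) (y - 1) +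
      (triBound y y y y - triBound y (y - 1) (y - 1) (y - 1)) / 3 * (e₁ + e₂ + e₃) := by
  obtain ⟨z, hz⟩ : ∃ z : ℝ, z = y - 4 := ⟨_, rfl⟩
  have hz0 : 0 ≤ z := by rw [hz, sub_nonneg]; exact_mod_cast hy
  have hyz : (y : ℝ) = z + 4 := by rw [hz]; ring
  unfold triBound
  rw [hyz]
  rcases h₁ with rfl | rfl <;> rcases h₂ with rfl | rfl <;> rcases h₃ with rfl | rfl <;>
    nlinarith [mul_nonneg hz0 hz0]

end Lists
end FiveCrit

namespace FiveCrit

variable {V : Type} {y : ℕ} {G : SimpleGraph V} {T U W : Finset V} {K : ℝ}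

/-- The number of neighbours of `v` in `T`. -/
noncomputable def deg (G : SimpleGraph V) (T : Finset V) (v : V) : ℕ :=
  (T.filter fun u => G.Adj v u).card

theorem exists_adj_of_deg {v : V} (h : 1 ≤ deg G T v) : ∃ x ∈ T, G.Adj v x := by
  obtain ⟨x, hx⟩ := card_pos.1 h
  exact ⟨x, mem_filter.1 hx⟩

variable [Fintype V]

theorem card_avail_le_of_deg {f : V → Fin (y + 1)} {v : V} (h : 1 ≤ deg G T v) :
    (avail G T f v).card ≤ y := by
  obtain ⟨x, hx, hvx⟩ := exists_adj_of_deg h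
  exact card_avail_le_one hx hvx

theorem Spread.sum_pair (hS : Spread y G T K) {x x' : V} (hx : x ∈ T) (hx' : x' ∈ T)
    (hne : x ≠ x') : (∑ f ∈ cols y G T, if f x = f x' then (1 : ℝ) else 0) * y ≤ K := by
  rw [sum_boole]
  exact hS.pair x hx x' hx' hne

theorem Spread.sum_two (hS : Spread y G T K) {x x' z z' : V} (hx : x ∈ T) (hx' : x' ∈ T)
    (hz : z ∈ T) (hz' : z' ∈ T) (hne : x ≠ x') (hzne : z ≠ z') (hs : s(x, x') ≠ s(z, z')) :
    (∑ f ∈ cols y G T, if f x = f x' ∧ f z = f z' then (1 : ℝ) else 0) * y ^ 2 ≤ K := by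
  rw [sum_boole]
  exact hS.two x hx x' hx' z hz z' hz' hne hzne hs

/-- At `v` at most `y - 1` colours are available, plus one for a set of colourings of `T` of
total weight at most `E`. -/
def Excess (y : ℕ) (G : SimpleGraph V) (T : Finset V) (v : V) (E : ℝ) : Prop :=
  ∃ ε : (V → Fin (y + 1)) → ℕ, (∀ f, ε f = 0 ∨ ε f = 1) ∧
    (∀ f ∈ cols y G T, (avail G T f v).card ≤ y - 1 + ε f) ∧
    ∑ f ∈ cols y G T, (ε f : ℝ) ≤ E

theorem Excess.of_adj {v x x' : V} (hx : x ∈ T) (hx' : x' ∈ T) (hxx : G.Adj x x')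
    (hvx : G.Adj v x) (hvx' : G.Adj v x') : Excess y G T v 0 := by
  refine ⟨fun _ => 0, fun _ => Or.inl rfl, fun f hf => ?_, by simp⟩
  have := card_avail_le_of_subset (f := f) (v := v) (G := G) (T := T) (X := {x, x'})
    (by simp [insert_subset_iff, hx, hx']) (by simp [hvx, hvx'])
  rw [image_insert, image_singleton, card_pair ((mem_cols.1 hf).2 x hx x' hx' hxx)] at this
  omega

theorem Spread.excess (hS : Spread y G T K) (hy : 1 ≤ y) {v : V} (h : 2 ≤ deg G T v) :
    Excess y G T v (K / y) := by
  obtain ⟨x, hx, x', hx', hne⟩ := one_lt_card.1 h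
  rw [mem_filter] at hx hx'
  refine ⟨fun f => if f x = f x' then 1 else 0, fun f => by dsimp only; split_ifs <;> simp,
    fun f _ => ?_, ?_⟩
  · dsimp only
    split_ifs with hf
    · have := card_avail_le_one (f := f) hx.1 hx.2
      omega
    · have := card_avail_le_of_subset (f := f) (v := v) (G := G) (T := T) (X := {x, x'})
        (by simp [insert_subset_iff, hx.1, hx'.1]) (by simp [hx.2, hx'.2])
      rw [image_insert, image_singleton, card_pair hf] at this
      omega
  · have hpos : (0 : ℝ) < y := by exact_mod_cast hy
    rw [le_div_iff₀ hpos]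
    push_cast
    exact hS.sum_pair hx.1 hx'.1 hne

/-- At a vertex with three neighbours in `T` at most `y - 2` colours are available, up to an
excess that is small on average. -/
theorem Spread.excess_three (hS : Spread y G T K) (hy : 3 ≤ y) {v : V} (h : 3 ≤ deg G T v) :
    ∃ ε : (V → Fin (y + 1)) → ℝ,
      (∀ f, ((avail G T f v).card : ℝ) ≤ y - 2 + ε f) ∧
      (∀ f, ((avail G T f v).card : ℝ) ^ 2 ≤ (y - 2) ^ 2 + (2 * y - 3) * ε f) ∧
      (∑ f ∈ cols y G T, ε f) * y ≤ 3 * K := by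
  obtain ⟨x₁, x₂, x₃, h1, h2, h3, h12, h13, h23⟩ := two_lt_card_iff.1 h
  rw [mem_filter] at h1 h2 h3
  have hy' : (3 : ℝ) ≤ y := by exact_mod_cast hy
  let e : (V → Fin (y + 1)) → ℝ := fun f => (if f x₁ = f x₂ then 1 else 0) +
    (if f x₁ = f x₃ then 1 else 0) + (if f x₂ = f x₃ then 1 else 0)
  have key : ∀ f : V → Fin (y + 1), e f = 0 ∧ (avail G T f v).card + 2 ≤ y ∨
      e f = 1 ∧ (avail G T f v).card + 1 ≤ y ∨ e f = 3 ∧ (avail G T f v).card ≤ y := by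
    intro f
    have h4 := card_avail_le_of_subset (f := f) (v := v) (G := G) (T := T) (X := {x₁, x₂, x₃})
        (by simp [insert_subset_iff, h1.1, h2.1, h3.1]) (by simp [h1.2, h2.2, h3.2])
    rw [image_insert, image_insert, image_singleton] at h4
    by_cases c12 : f x₁ = f x₂
    · by_cases c13 : f x₁ = f x₃
      · have c23 : f x₂ = f x₃ := c12 ▸ c13
        exact Or.inr (Or.inr ⟨by simp only [e, c12, c23, if_true]; norm_num,
          card_avail_le_one h1.1 h1.2⟩)
      · have c23 : f x₂ ≠ f x₃ := c12 ▸ c13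
        rw [c12, insert_eq_of_mem (by simp), card_pair c23] at h4
        exact Or.inr (Or.inl ⟨by simp only [e, c12, c23, if_true, if_false]; norm_num, by omega⟩)
    · by_cases c13 : f x₁ = f x₃
      · have c23 : f x₂ ≠ f x₃ := fun h => c12 (c13.trans h.symm)
        rw [c13, insert_eq_of_mem (by simp), card_pair c23] at h4
        exact Or.inr (Or.inl ⟨by simp only [e, c13, c23, c23.symm, if_true, if_false]; norm_num,
          by omega⟩)
      · by_cases c23 : f x₂ = f x₃
        · rw [c23, pair_eq_singleton, card_pair c13] at h4
          exact Or.inr (Or.inl ⟨by simp only [e, c13, c23, if_true, if_false]; norm_num,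
            by omega⟩)
        · rw [card_eq_three.2 ⟨_, _, _, c12, c13, c23, rfl⟩] at h4
          exact Or.inl ⟨by simp only [e, c12, c13, c23, if_false]; norm_num, by omega⟩
  refine ⟨e, fun f => ?_, fun f => ?_, ?_⟩
  · rcases key f with ⟨h, h'⟩ | ⟨h, h'⟩ | ⟨h, h'⟩ <;>
    · have := Nat.cast_le (α := ℝ).2 h'
      push_cast at this
      rw [h]
      linarith
  · have h0 : (0 : ℝ) ≤ (avail G T f v).card := Nat.cast_nonneg _
    have hsq : ∀ t : ℝ, ((avail G T f v).card : ℝ) ≤ t → ((avail G T f v).card : ℝ) ^ 2 ≤ t ^ 2 :=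
      fun t ht => pow_le_pow_left₀ h0 ht 2
    rcases key f with ⟨h, h'⟩ | ⟨h, h'⟩ | ⟨h, h'⟩
    all_goals
      have := Nat.cast_le (α := ℝ).2 h'
      push_cast at this
      rw [h]
    · linarith [hsq (y - 2) (by linarith)]
    · linarith [hsq (y - 1) (by linarith)]
    · linarith [hsq y this]
  · simp only [e, sum_add_distrib, add_mul]
    linarith [hS.sum_pair h1.1 h2.1 h12, hS.sum_pair h1.1 h3.1 h13, hS.sum_pair h2.1 h3.1 h23]

/-! ### Adding one, two or three vertices -/

theorem card_cols_insert_le_sum {v : V} :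
    (cols y G (insert v T)).card ≤ ∑ f ∈ cols y G T, (avail G T f v).card := by
  refine card_cols_le_sum (subset_insert v T) (fun F => F v) (fun f => avail G T f v)
    (fun F hF => mem_avail hF (subset_insert v T) (mem_insert_self v T)) ?_
  intro F _ F' _ hE w hw hwT
  rw [(mem_insert.1 hw).resolve_right hwT]
  exact hE

theorem card_cols_pair_le_prod {u v : V} :
    (cols y G (insert u (insert v T))).card ≤
      ∑ f ∈ cols y G T, (avail G T f u).card * (avail G T f v).card := by
  have hsub : T ⊆ insert u (insert v T) := (subset_insert _ _).trans (subset_insert _ _)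
  refine (card_cols_le_sum hsub (fun F => (F u, F v))
    (fun f => avail G T f u ×ˢ avail G T f v) (fun F hF => ?_) ?_).trans
    (sum_le_sum fun f _ => (card_product _ _).le)
  · exact mem_product.2 ⟨mem_avail hF hsub (by simp), mem_avail hF hsub (by simp)⟩
  · intro F _ F' _ hE w hw hwT
    simp only [Prod.mk.injEq] at hE
    simp only [mem_insert, hwT, or_false] at hw
    rcases hw with rfl | rfl
    exacts [hE.1, hE.2]

theorem card_cols_edge_le {u v : V} (huv : G.Adj u v) :
    (cols y G (insert u (insert v T))).card ≤
      ∑ f ∈ cols y G T, (edgeSet (avail G T f u) (avail G T f v)).card := by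
  have hsub : T ⊆ insert u (insert v T) := (subset_insert _ _).trans (subset_insert _ _)
  refine card_cols_le_sum hsub (fun F => (F u, F v))
    (fun f => edgeSet (avail G T f u) (avail G T f v)) (fun F hF => ?_) ?_
  · exact mem_filter.2 ⟨mem_product.2 ⟨mem_avail hF hsub (by simp), mem_avail hF hsub (by simp)⟩,
      (mem_cols.1 hF).2 u (by simp) v (by simp) huv⟩
  · intro F _ F' _ hE w hw hwT
    simp only [Prod.mk.injEq] at hE
    simp only [mem_insert, hwT, or_false] at hw
    rcases hw with rfl | rfl
    exacts [hE.1, hE.2]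

theorem card_cols_tri_le {a b c : V} (hab : G.Adj a b) (hac : G.Adj a c) (hbc : G.Adj b c) :
    (cols y G (insert a (insert b (insert c T)))).card ≤
      ∑ f ∈ cols y G T, (triSet (avail G T f a) (avail G T f b) (avail G T f c)).card := by
  have hsub : T ⊆ insert a (insert b (insert c T)) :=
    (subset_insert _ _).trans ((subset_insert _ _).trans (subset_insert _ _))
  refine card_cols_le_sum hsub (fun F => (F a, F b, F c))
    (fun f => triSet (avail G T f a) (avail G T f b) (avail G T f c)) (fun F hF => ?_) ?_
  · have hp := (mem_cols.1 hF).2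
    exact mem_filter.2 ⟨mem_product.2 ⟨mem_avail hF hsub (by simp), mem_product.2
      ⟨mem_avail hF hsub (by simp), mem_avail hF hsub (by simp)⟩⟩,
      hp a (by simp) b (by simp) hab, hp a (by simp) c (by simp) hac,
      hp b (by simp) c (by simp) hbc⟩
  · intro F _ F' _ hE w hw hwT
    simp only [Prod.mk.injEq] at hE
    simp only [mem_insert, hwT, or_false] at hw
    rcases hw with rfl | rfl | rfl
    exacts [hE.1, hE.2.1, hE.2.2]

theorem card_cols_tri_le_of_excess (hy : 4 ≤ y) {a b c : V} (hab : G.Adj a b) (hac : G.Adj a c)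
    (hbc : G.Adj b c) {A B C : ℝ} (ha : Excess y G T a A) (hb : Excess y G T b B)
    (hc : Excess y G T c C) :
    ((cols y G (insert a (insert b (insert c T)))).card : ℝ) ≤
      triBound y (y - 1) (y - 1) (y - 1) * (cols y G T).card +
      (triBound y y y y - triBound y (y - 1) (y - 1) (y - 1)) / 3 * (A + B + C) := by
  obtain ⟨ε₁, h1, l1, s1⟩ := ha
  obtain ⟨ε₂, h2, l2, s2⟩ := hb
  obtain ⟨ε₃, h3, l3, s3⟩ := hc
  have hcast := Nat.cast_le (α := ℝ).2 (card_cols_tri_le (y := y) (T := T) hab hac hbc)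
  rw [Nat.cast_sum] at hcast
  have hlin : ∀ f ∈ cols y G T,
      ((triSet (avail G T f a) (avail G T f b) (avail G T f c)).card : ℝ) ≤
      triBound y (y - 1) (y - 1) (y - 1) +
      (triBound y y y y - triBound y (y - 1) (y - 1) (y - 1)) / 3 *
        ((ε₁ f : ℝ) + ε₂ f + ε₃ f) := by
    intro f hf
    have hle : ∀ n : ℕ, n = 0 ∨ n = 1 → n ≤ 1 := by omega
    have e1 := hle _ (h1 f)
    have e2 := hle _ (h2 f)
    have e3 := hle _ (h3 f)
    have := card_triSet_le (l1 f hf) (l2 f hf) (l3 f hf) (by omega) (by omega) (by omega)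
      (by omega) (by omega) (by omega)
    push_cast [Nat.cast_sub (show 1 ≤ y by omega)] at this
    exact this.trans (triBound_le hy (by exact_mod_cast h1 f) (by exact_mod_cast h2 f)
      (by exact_mod_cast h3 f))
  have hcoef : 0 ≤ (triBound y y y y - triBound y (y - 1) (y - 1) (y - 1)) / 3 := by
    have hy' : (4 : ℝ) ≤ y := by exact_mod_cast hy
    unfold triBound
    nlinarith
  refine (hcast.trans (sum_le_sum hlin)).trans ?_
  rw [sum_add_distrib, sum_const, nsmul_eq_mul, ← mul_sum, sum_add_distrib, sum_add_distrib,
    mul_comm ((cols y G T).card : ℝ)]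
  gcongr

theorem card_cols_tri_le_of_deg (hy : 4 ≤ y) {a b c : V} (hab : G.Adj a b) (hac : G.Adj a c)
    (hbc : G.Adj b c) (ha : 1 ≤ deg G T a) (hb : 1 ≤ deg G T b) (hc : 1 ≤ deg G T c) :
    ((cols y G (insert a (insert b (insert c T)))).card : ℝ) ≤
      triBound y y y y * (cols y G T).card := by
  have hcast := Nat.cast_le (α := ℝ).2 (card_cols_tri_le (y := y) (T := T) hab hac hbc)
  rw [Nat.cast_sum] at hcast
  refine hcast.trans ?_
  rw [mul_comm, ← nsmul_eq_mul]
  exact sum_le_card_nsmul _ _ _ fun f _ => card_triSet_le (card_avail_le_of_deg ha)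
    (card_avail_le_of_deg hb) (card_avail_le_of_deg hc) (by omega) (by omega) (by omega)
    (by omega) (by omega) (by omega)

end FiveCrit

namespace FiveCrit

variable {V : Type} {y k : ℕ} {G : SimpleGraph V} {T U W : Finset V} {K : ℝ}

theorem deg_insert_le {u v : V} : deg G (insert u T) v ≤ deg G T v + 1 := by
  unfold deg
  rw [filter_insert]
  split_ifs
  · exact card_insert_le _ _
  · omega

theorem deg_insert_of_not_adj {u v : V} (h : ¬ G.Adj v u) : deg G (insert u T) v = deg G T v := by
  unfold deg
  rw [filter_insert, if_neg h]

theorem deg_insert_of_adj {u v : V} (hu : u ∉ T) (h : G.Adj v u) :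
    deg G (insert u T) v = deg G T v + 1 := by
  unfold deg
  rw [filter_insert, if_pos h, card_insert_of_notMem]
  simp [hu]

theorem deg_mono {v : V} (h : T ⊆ U) : deg G T v ≤ deg G U v :=
  card_le_card (filter_subset_filter _ h)

theorem Crit.le_deg (h : Crit k G W) {v : V} (hv : v ∈ W) : k ≤ deg G W v := h.le_degree hv

theorem Conn.insert_deg (hT : Conn G T) {v : V} (h : 1 ≤ deg G T v) : Conn G (insert v T) := by
  obtain ⟨x, hx, hvx⟩ := exists_adj_of_deg h
  exact hT.insert_adj hx hvx.symm

/-- The structure of triangle-free critical graphs that are not `3`-colourable: for some vertex `v`,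
the non-neighbours of `v` induce a connected graph that is not bipartite. -/
theorem Crit.exists_triangleFree_structure (h : Crit 3 G W) (htri : ¬ HasTri G W) :
    ∃ v ∈ W, ∃ D ⊆ W, ∃ B ⊆ W, Conn G D ∧ ¬ Col 2 G D ∧ 3 ≤ B.card ∧ v ∉ D ∧
      (∀ u ∈ B, u ∉ D ∧ u ≠ v ∧ G.Adj u v ∧ 2 ≤ deg G D u) := by
  have hex : ∃ v ∈ W, ∃ D ⊆ W, Conn G D ∧ ¬ Col 2 G D ∧ ∀ u ∈ D, u ≠ v ∧ ¬ G.Adj v u := by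
    obtain ⟨v, hv⟩ := h.nonempty
    have hcol : ¬ Col 2 G (W.filter fun u => u ≠ v ∧ ¬ G.Adj v u) := by
      rintro ⟨f, hf⟩
      refine h.1 ⟨fun u => if u = v then 0 else if G.Adj v u then 2 else (f u).castSucc,
        fun a ha b hb hab => ?_⟩
      have hlt : ∀ c : Fin 2, c.castSucc ≠ (2 : Fin 3) := by decide
      by_cases hav : a = v
      · subst hav
        simp [hab.ne', hab]
      by_cases hbv : b = v
      · subst hbv
        simp [hab.ne, hab.symm]
      by_cases h1 : G.Adj v a
      · by_cases h2 : G.Adj v b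
        · exact absurd ⟨v, hv, a, ha, b, hb, h1, h2, hab⟩ htri
        · simpa [hav, hbv, h1, h2] using (hlt (f b)).symm
      · by_cases h2 : G.Adj v b
        · simpa [hav, hbv, h1, h2] using hlt (f a)
        · simpa [hav, hbv, h1, h2] using hf a (by simp [ha, hav, h1]) b (by simp [hb, hbv, h2]) hab
    obtain ⟨D, hD, hDc⟩ := exists_crit hcol
    exact ⟨v, hv, D, hD.trans (filter_subset _ _), hDc.conn, hDc.1,
      fun u hu => (mem_filter.1 (hD hu)).2⟩
  obtain ⟨v₀, hv₀, D₀, hD₀W, hD₀⟩ := hex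
  obtain ⟨⟨v, D⟩, hvD, hmax⟩ := exists_max_image ((W ×ˢ W.powerset).filter fun p =>
    Conn G p.2 ∧ ¬ Col 2 G p.2 ∧ ∀ u ∈ p.2, u ≠ p.1 ∧ ¬ G.Adj p.1 u) (fun p => p.2.card)
    ⟨(v₀, D₀), by simpa [hv₀, hD₀W] using hD₀⟩
  simp only [mem_filter, mem_product, mem_powerset] at hvD hmax
  obtain ⟨⟨hv, hDW⟩, hconn, hcol, hval⟩ := hvD
  have hvD : v ∉ D := fun h => (hval v h).1 rfl
  let B := W.filter fun u => u ∉ D ∧ ∃ d ∈ D, G.Adj d u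
  have hB : ∀ {u}, u ∈ B ↔ u ∈ W ∧ u ∉ D ∧ ∃ d ∈ D, G.Adj d u := fun {u} => mem_filter
  have h1 : ∀ z ∈ W, (∀ u ∈ D, u ≠ z ∧ ¬ G.Adj z u) → ∀ u ∈ B, G.Adj z u := by
    intro z hz hzD u hu
    obtain ⟨huW, huD, d, hd, hdu⟩ := hB.1 hu
    by_contra hc
    have := hmax (z, insert u D) ⟨⟨hz, insert_subset huW hDW⟩, hconn.insert_adj hd hdu,
      fun h => hcol (h.mono (subset_insert _ _)), fun w hw => by
        rcases mem_insert.1 hw with rfl | hw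
        · exact ⟨fun h => (hzD d hd).2 (h ▸ hdu).symm, hc⟩
        · exact hzD w hw⟩
    rw [card_insert_of_notMem huD] at this
    simp at this
  have hBne : ∃ u, u ∈ B := by
    obtain ⟨u, hu, huD, d, hd, hdu⟩ := h.conn.exists_adj hDW hconn.1 fun h => hvD (h ▸ hv)
    exact ⟨u, hB.2 ⟨hu, huD, d, hd, hdu⟩⟩
  have h2 : ∀ z ∈ W, (∀ u ∈ D, u ≠ z ∧ ¬ G.Adj z u) → z = v := by
    intro z hz hzD
    by_contra hne
    obtain ⟨w, hw, hzw, hvw⟩ := h.exists_not_adj hz hv hne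
    have hwD : w ∉ D := fun h => (hzD w h).2 hzw
    have hwB : w ∉ B := fun h => hvw (h1 v hv hval w h)
    obtain ⟨u, hu⟩ := hBne
    exact htri ⟨z, hz, w, hw, u, (hB.1 hu).1, hzw, h1 z hz hzD u hu, h1 w hw (fun d hd =>
      ⟨fun h => hwD (h ▸ hd), fun hwd => hwB (hB.2 ⟨hw, hwD, d, hd, hwd.symm⟩)⟩) u hu⟩
  have h3 : ∀ w ∈ W, w ∉ D → w ∉ B → w = v := fun w hw hwD hwB => h2 w hw fun d hd =>
    ⟨fun h => hwD (h ▸ hd), fun hwd => hwB (hB.2 ⟨hw, hwD, d, hd, hwd.symm⟩)⟩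
  have hBW : B ⊆ W := filter_subset _ _
  refine ⟨v, hv, D, hDW, B, hBW, hconn, hcol, ?_, hvD, fun u hu => ?_⟩
  · refine (h.le_deg hv).trans (card_le_card fun u hu => ?_)
    obtain ⟨hu, hvu⟩ := mem_filter.1 hu
    by_contra hc
    exact hvu.ne (h3 u hu (fun huD => (hval u huD).2 hvu) hc).symm
  · have huv := h1 v hv hval u hu
    refine ⟨(hB.1 hu).2.1, huv.ne', huv.symm, ?_⟩
    have h4 : deg G W u ≤ deg G (insert v D) u := by
      refine card_le_card fun w hw => ?_
      rw [mem_filter] at hw ⊢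
      refine ⟨?_, hw.2⟩
      by_contra hc
      rw [mem_insert, not_or] at hc
      have hwB : w ∈ B := by_contra fun h => hc.1 (h3 w hw.1 hc.2 h)
      exact htri ⟨v, hv, u, hBW hu, w, hw.1, huv, h1 v hv hval w hwB, hw.2⟩
    have h5 := h.le_deg (hBW hu)
    have h6 := deg_insert_le (G := G) (T := D) (u := v) (v := u)
    omega

variable [Fintype V]

theorem card_cols_insert_le_of_clique {v : V} {X : Finset V} (hX : X ⊆ T)
    (hclique : ∀ a ∈ X, ∀ b ∈ X, a ≠ b → G.Adj a b) (hv : ∀ x ∈ X, G.Adj v x) :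
    (cols y G (insert v T)).card ≤ (cols y G T).card * (y + 1 - X.card) := by
  refine card_cols_insert_le_sum.trans (sum_le_card_nsmul _ _ _ fun f hf => ?_)
  have h1 := card_avail_le_of_subset (f := f) hX hv
  rw [card_image_of_injOn] at h1
  · omega
  · intro a ha b hb hab
    by_contra hne
    exact (mem_cols.1 hf).2 a (hX ha) b (hX hb) (hclique a ha b hb hne) hab

theorem Spread.card_cols_pair_le (hS : Spread y G T K) (hy : 4 ≤ y) {u v : V}
    (hu : 3 ≤ deg G T u) (hv : 3 ≤ deg G T v) :
    ((cols y G (insert u (insert v T))).card : ℝ) ≤ y * (y - 2) * K := by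
  obtain ⟨ε₁, -, h1, s1⟩ := hS.excess_three (by omega) hu
  obtain ⟨ε₂, -, h2, s2⟩ := hS.excess_three (by omega) hv
  have hcast := Nat.cast_le (α := ℝ).2 (card_cols_pair_le_prod (y := y) (G := G) (T := T)
    (u := u) (v := v))
  push_cast at hcast
  have hy' : (4 : ℝ) ≤ y := by exact_mod_cast hy
  have hle : ∑ f ∈ cols y G T, ((avail G T f u).card * (avail G T f v).card : ℝ) ≤
      ∑ f ∈ cols y G T, ((y - 2) ^ 2 + (2 * y - 3) / 2 * (ε₁ f + ε₂ f) : ℝ) := by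
    refine sum_le_sum fun f _ => ?_
    have := h1 f
    have := h2 f
    nlinarith [sq_nonneg ((avail G T f u).card - (avail G T f v).card : ℝ)]
  rw [sum_add_distrib, sum_const, nsmul_eq_mul, ← mul_sum, sum_add_distrib] at hle
  have htot := hS.total
  have hK := hS.nonneg
  refine le_of_mul_le_mul_right ?_ (show (0 : ℝ) < y by linarith)
  have h3 := mul_le_mul_of_nonneg_right (hcast.trans hle) (show (0 : ℝ) ≤ y by linarith)
  refine h3.trans ?_
  have h4 := mul_le_mul_of_nonneg_right htot (show (0 : ℝ) ≤ (y - 2) ^ 2 * y by positivity)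
  have h5 := mul_le_mul_of_nonneg_left (add_le_add s1 s2)
    (show (0 : ℝ) ≤ (2 * y - 3) / 2 by linarith)
  have h6 : (0 : ℝ) ≤ K * (2 * y ^ 2 - 10 * y + 9) :=
    mul_nonneg hK (by nlinarith)
  nlinarith

theorem mul_mul_le_sum_cubes {a b c : ℝ} (ha : 0 ≤ a) (hb : 0 ≤ b) (hc : 0 ≤ c) :
    a * b * c ≤ (a ^ 3 + b ^ 3 + c ^ 3) / 3 := by
  nlinarith [mul_nonneg (add_nonneg (add_nonneg ha hb) hc) (sq_nonneg (a - b)),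
    mul_nonneg (add_nonneg (add_nonneg ha hb) hc) (sq_nonneg (a - c)),
    mul_nonneg (add_nonneg (add_nonneg ha hb) hc) (sq_nonneg (b - c))]

theorem sum_card_erase_pow {A : Finset (Fin (y + 1))} {m : ℕ} (hA : A.card ≤ m) (hm1 : 1 ≤ m)
    (hm : m ≤ y + 1) :
    ∑ c, ((A.erase c).card : ℝ) ^ 3 ≤ m * (m - 1) ^ 3 + (y + 1 - m) * m ^ 3 := by
  obtain ⟨A', hAA, rfl⟩ := exists_superset_of_card_le hA hm
  have h1 : ∑ c, ((A.erase c).card : ℝ) ^ 3 ≤ ∑ c, ((A'.erase c).card : ℝ) ^ 3 := by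
    gcongr
  refine h1.trans (le_of_eq ?_)
  rw [← sum_add_sum_compl A']
  rw [sum_congr rfl (g := fun _ => ((A'.card : ℝ) - 1) ^ 3), sum_congr (s₂ := A'ᶜ) rfl
    (g := fun _ => (A'.card : ℝ) ^ 3), sum_const, sum_const, nsmul_eq_mul, nsmul_eq_mul,
    card_compl, Fintype.card_fin, Nat.cast_sub hm]
  · push_cast; ring
  · intro c hc
    rw [erase_eq_of_notMem (mem_compl.1 hc)]
  · intro c hc
    rw [card_erase_of_mem hc, Nat.cast_sub hm1, Nat.cast_one]

theorem card_cols_join_le {D : Finset V} {v u₁ u₂ u₃ : V} (h1 : G.Adj u₁ v) (h2 : G.Adj u₂ v)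
    (h3 : G.Adj u₃ v) :
    ((cols y G (insert v (insert u₁ (insert u₂ (insert u₃ D))))).card : ℝ) ≤
      ∑ f ∈ cols y G D, ∑ c, ((((avail G D f u₁).erase c).card : ℝ) ^ 3 +
        (((avail G D f u₂).erase c).card : ℝ) ^ 3 + (((avail G D f u₃).erase c).card : ℝ) ^ 3) / 3
    := by
  have hsub : D ⊆ insert v (insert u₁ (insert u₂ (insert u₃ D))) := by
    intro x hx
    simp [hx]
  have h := card_cols_le_sum (y := y) (G := G) hsub (C := Σ _ : Fin (y + 1), _ × _ × _)
    (fun F => ⟨F v, F u₁, F u₂, F u₃⟩)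
    (fun f => univ.sigma fun c => (avail G D f u₁).erase c ×ˢ (avail G D f u₂).erase c ×ˢ
      (avail G D f u₃).erase c) (fun F hF => by
        have hp := (mem_cols.1 hF).2
        simp only [mem_sigma, mem_univ, mem_product, mem_erase, true_and]
        exact ⟨⟨hp _ (by simp) _ (by simp) h1, mem_avail hF hsub (by simp)⟩,
          ⟨hp _ (by simp) _ (by simp) h2, mem_avail hF hsub (by simp)⟩,
          ⟨hp _ (by simp) _ (by simp) h3, mem_avail hF hsub (by simp)⟩⟩) (by
        intro F _ F' _ hE w hw hwT
        simp only [Sigma.mk.injEq, heq_eq_eq, Prod.mk.injEq] at hE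
        simp only [mem_insert, hwT, or_false] at hw
        rcases hw with rfl | rfl | rfl | rfl
        exacts [hE.1, hE.2.1, hE.2.2.1, hE.2.2.2])
  have hcast := Nat.cast_le (α := ℝ).2 h
  refine hcast.trans ?_
  push_cast
  refine sum_le_sum fun f _ => ?_
  rw [card_sigma, Nat.cast_sum]
  refine sum_le_sum fun c _ => ?_
  rw [card_product, card_product]
  push_cast
  rw [← mul_assoc]
  exact mul_mul_le_sum_cubes (Nat.cast_nonneg _) (Nat.cast_nonneg _) (Nat.cast_nonneg _)

theorem sum_sum_card_erase_pow_le (hy : 4 ≤ y) (hS : Spread y G T K) {u : V}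
    (hu : 2 ≤ deg G T u) :
    ∑ f ∈ cols y G T, ∑ c, (((avail G T f u).erase c).card : ℝ) ^ 3 ≤
      K * ((y + 1) * (y - 1) * (y - 2) * y) := by
  obtain ⟨ε, h01, hε, hsum⟩ := hS.excess (by omega) hu
  have hy' : (4 : ℝ) ≤ y := by exact_mod_cast hy
  have h1 : ∀ f ∈ cols y G T, ∑ c, (((avail G T f u).erase c).card : ℝ) ^ 3 ≤
      ((y - 1) * (y - 2) ^ 3 + 2 * (y - 1) ^ 3) +
        (y * (y - 1) ^ 3 + y ^ 3 - ((y - 1) * (y - 2) ^ 3 + 2 * (y - 1) ^ 3)) * (ε f : ℝ) := by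
    intro f hf
    have hl := hε f hf
    rcases h01 f with h | h <;> rw [h] at hl
    · have := sum_card_erase_pow hl (by omega) (by omega)
      push_cast [Nat.cast_sub (show 1 ≤ y by omega)] at this
      rw [h]
      push_cast
      linarith
    · have := sum_card_erase_pow hl (by omega) (by omega)
      push_cast [Nat.cast_sub (show 1 ≤ y by omega)] at this
      rw [h]
      push_cast
      linarith
  refine (sum_le_sum h1).trans ?_
  rw [sum_add_distrib, sum_const, nsmul_eq_mul, ← mul_sum]
  have hpos : (0 : ℝ) < y := by linarith
  have hK := hS.nonneg
  rw [le_div_iff₀ hpos] at hsum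
  refine le_of_mul_le_mul_right ?_ hpos
  obtain ⟨z, hz⟩ : ∃ z : ℝ, z = y - 4 := ⟨_, rfl⟩
  have hz0 : 0 ≤ z := by rw [hz]; linarith
  have hyz : (y : ℝ) = z + 4 := by rw [hz]; ring
  have e1 : (0 : ℝ) ≤ (y - 1) * (y - 2) ^ 3 + 2 * (y - 1) ^ 3 := by rw [hyz]; ring_nf; positivity
  have e2 : (0 : ℝ) ≤ y * (y - 1) ^ 3 + y ^ 3 - ((y - 1) * (y - 2) ^ 3 + 2 * (y - 1) ^ 3) := by
    rw [hyz]; ring_nf; positivity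
  have e3 : (0 : ℝ) ≤ (y + 1) * (y - 1) * (y - 2) * y * y -
      ((y - 1) * (y - 2) ^ 3 + 2 * (y - 1) ^ 3) * y -
      (y * (y - 1) ^ 3 + y ^ 3 - ((y - 1) * (y - 2) ^ 3 + 2 * (y - 1) ^ 3)) := by
    rw [hyz]; ring_nf; positivity
  have m1 := mul_le_mul_of_nonneg_right hS.total (mul_nonneg e1 hpos.le)
  have m2 := mul_le_mul_of_nonneg_left hsum e2
  have m3 := mul_nonneg hK e3
  linarith

end FiveCrit

namespace FiveCrit

variable {V : Type} [Fintype V] {y k : ℕ} {G : SimpleGraph V} {T U W : Finset V} {K : ℝ}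

theorem card_cols_le_of_subset {κ : ℝ} (hW : Conn G W) (hUW : U ⊆ W) (hU : U.Nonempty)
    (h : ((cols y G U).card : ℝ) ≤ κ * y ^ U.card) : ((cols y G W).card : ℝ) ≤ κ * y ^ W.card := by
  have hcast := Nat.cast_le (α := ℝ).2 (card_cols_le_of_conn (y := y) hW hUW hU)
  push_cast at hcast
  refine hcast.trans ((mul_le_mul_of_nonneg_right h (by positivity)).trans (le_of_eq ?_))
  rw [mul_assoc, ← pow_add, add_comm, card_sdiff_add_card_eq_card hUW]

theorem card_cols_edge_le_of_excess (hy : 4 ≤ y) {u v : V} (huv : G.Adj u v) {A B : ℝ}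
    (hu : Excess y G T u A) (hv : Excess y G T v B) :
    ((cols y G (insert u (insert v T))).card : ℝ) ≤
      (y ^ 2 - 3 * y + 4) * (cols y G T).card + (y - 3 / 2) * (A + B) := by
  obtain ⟨ε₁, h1, l1, s1⟩ := hu
  obtain ⟨ε₂, h2, l2, s2⟩ := hv
  have hcast := Nat.cast_le (α := ℝ).2 (card_cols_edge_le (y := y) (T := T) huv)
  rw [Nat.cast_sum] at hcast
  have hy' : (4 : ℝ) ≤ y := by exact_mod_cast hy
  have hle : ∀ f ∈ cols y G T, ((edgeSet (avail G T f u) (avail G T f v)).card : ℝ) ≤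
      (y ^ 2 - 3 * y + 4) + (y - 3 / 2) * (ε₁ f + ε₂ f) := by
    intro f hf
    have := card_edgeSet_le (l1 f hf) (l2 f hf) (by omega) (by omega)
    refine this.trans ?_
    push_cast [Nat.cast_sub (show 1 ≤ y by omega)]
    rcases h1 f with h1 | h1 <;> rcases h2 f with h2 | h2 <;> rw [h1, h2] <;> push_cast <;>
      nlinarith
  refine hcast.trans ((sum_le_sum hle).trans ?_)
  rw [sum_add_distrib, sum_const, nsmul_eq_mul, ← mul_sum, sum_add_distrib]
  have := mul_le_mul_of_nonneg_left (add_le_add s1 s2) (show (0 : ℝ) ≤ y - 3 / 2 by linarith)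
  linarith

theorem Crit.card_cols_le_of_triangleFree (hy : 4 ≤ y) (h : Crit 3 G W) (htri : ¬ HasTri G W) :
    ((cols y G W).card : ℝ) ≤ (y + 1) * (y - 1) * (y - 2) / y ^ 3 * y ^ W.card := by
  obtain ⟨v, hv, D, hDW, B, hBW, hconn, hcol, hB, hvD, hBprop⟩ :=
    h.exists_triangleFree_structure htri
  obtain ⟨u₁, u₂, u₃, m1, m2, m3, h12, h13, h23⟩ := two_lt_card_iff.1 hB
  obtain ⟨n1, v1, a1, d1⟩ := hBprop _ m1
  obtain ⟨n2, v2, a2, d2⟩ := hBprop _ m2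
  obtain ⟨n3, v3, a3, d3⟩ := hBprop _ m3
  refine card_cols_le_of_subset (U := insert v (insert u₁ (insert u₂ (insert u₃ D)))) h.conn
    ?_ (insert_nonempty _ _) ?_
  · simp [insert_subset_iff, hv, hDW, hBW m1, hBW m2, hBW m3]
  have hS := (good_not_col_two (V := V) (y := y) (by omega)).spread (homClosed_not_col 2)
    zero_le_one hconn
    hcol
  have hj := card_cols_join_le (y := y) (D := D) a1 a2 a3
  simp_rw [← sum_div, sum_add_distrib] at hj
  have s1 := sum_sum_card_erase_pow_le hy hS d1
  have s2 := sum_sum_card_erase_pow_le hy hS d2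
  have s3 := sum_sum_card_erase_pow_le hy hS d3
  have hU : (insert v (insert u₁ (insert u₂ (insert u₃ D)))).card = D.card + 4 := by
    rw [card_insert_of_notMem, card_insert_of_notMem, card_insert_of_notMem,
      card_insert_of_notMem n3]
    · simp [h23, n2]
    · simp [h12, h13, n1]
    · simp [v1.symm, v2.symm, v3.symm, hvD]
  have hy' : (0 : ℝ) < y := by exact_mod_cast (by omega : 0 < y)
  have e : (y + 1) * (y - 1) * (y - 2) / y ^ 3 * (y : ℝ) ^ (D.card + 4) =
      1 * y ^ D.card * ((y + 1) * (y - 1) * (y - 2) * y) := by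
    field_simp
    ring
  rw [hU, e]
  linarith

theorem card_cols_triangle {a b c : V} (hab : G.Adj a b) (hac : G.Adj a c) (hbc : G.Adj b c) :
    (cols y G {a, b, c}).card ≤ (y + 1) * y * (y - 1) := by
  have h1 := card_cols_insert_le_of_clique (y := y) (G := G) (T := {b, c}) (v := a) (X := {b, c})
    subset_rfl (by simp +contextual [hbc, hbc.symm]) (by simp [hab, hac])
  have h2 := card_cols_insert_le (y := y) (G := G) (T := {c}) (mem_singleton_self c) hbc.symm
  rw [card_pair hbc.ne] at h1
  exact h1.trans (Nat.mul_le_mul (h2.trans (Nat.mul_le_mul_right _ (card_cols_singleton c)))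
    (by omega))

theorem Crit.card_cols_le_of_triangle (hy : 4 ≤ y) (h : Crit 3 G W) {a b c : V} (ha : a ∈ W)
    (hb : b ∈ W) (hc : c ∈ W) (hab : G.Adj a b) (hac : G.Adj a c) (hbc : G.Adj b c) :
    ((cols y G W).card : ℝ) ≤ (y + 1) * (y - 1) * (y - 2) / y ^ 3 * y ^ W.card := by
  have hy' : (4 : ℝ) ≤ y := by exact_mod_cast hy
  have hy0 : (0 : ℝ) < y := by linarith
  have hCW : {a, b, c} ⊆ W := by simp [insert_subset_iff, ha, hb, hc]
  have hC : ({a, b, c} : Finset V).card = 3 := by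
    rw [card_insert_of_notMem, card_pair hbc.ne]
    simp [hab.ne, hac.ne]
  have hne : 4 ≤ W.card := by
    have := h.le_deg ha
    have h1 : deg G W a < W.card := card_lt_card
      ((filter_ssubset).2 ⟨a, ha, G.irrefl⟩)
    omega
  have hCconn : Conn G {a, b, c} :=
    ((conn_singleton G c).insert_adj (mem_singleton_self c) hbc.symm).insert_adj
      (mem_insert_self b _) hab.symm
  have hCtri : HasTri G {a, b, c} := ⟨a, by simp, b, by simp, c, by simp, hab, hac, hbc⟩
  have hκ : (0 : ℝ) ≤ ((y : ℝ) ^ 2 - 1) / y ^ 2 := div_nonneg (by nlinarith) (by positivity)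
  have hcard := card_sdiff_add_card_eq_card hCW
  rw [hC] at hcard
  -- two vertices outside a connected set containing the triangle
  have hpair : ∀ T u v, Conn G T → {a, b, c} ⊆ T → W = insert u (insert v T) → u ∉ insert v T →
      v ∉ T → ¬ G.Adj u v →
      ((cols y G W).card : ℝ) ≤ (y + 1) * (y - 1) * (y - 2) / y ^ 3 * y ^ W.card := by
    intro T u v hT hCT hW huT hvT huv
    have hS := (good_hasTri (V := V) (y := y) (by omega)).spread homClosed_hasTri hκ hT
      (homClosed_hasTri.mono hCtri hCT)
    have d1 := h.le_deg (v := u) (by rw [hW]; simp)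
    have d2 := h.le_deg (v := v) (by rw [hW]; simp)
    rw [hW, deg_insert_of_not_adj G.irrefl, deg_insert_of_not_adj huv] at d1
    rw [hW, deg_insert_of_not_adj fun h => huv h.symm, deg_insert_of_not_adj G.irrefl] at d2
    have hp := hS.card_cols_pair_le hy d1 d2
    rw [hW, card_insert_of_notMem huT, card_insert_of_notMem hvT]
    refine hp.trans (le_of_eq ?_)
    field_simp
    ring
  rcases lt_or_ge W.card 6 with hW6 | hW6
  · rcases (by omega : (W \ {a, b, c}).card = 1 ∨ (W \ {a, b, c}).card = 2) with h1 | h2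
    · obtain ⟨d, hd⟩ := card_eq_one.1 h1
      have hdC : d ∉ ({a, b, c} : Finset V) := (mem_sdiff.1 (hd ▸ mem_singleton_self d)).2
      have hW : W = insert d {a, b, c} := by
        rw [← sdiff_union_of_subset hCW, hd]; simp only [singleton_union]
      have d1 := h.le_deg (v := d) (by rw [hW]; simp)
      rw [hW, deg_insert_of_not_adj G.irrefl] at d1
      have hall : ∀ x ∈ ({a, b, c} : Finset V), G.Adj d x := by
        have := eq_of_subset_of_card_le (filter_subset (fun x => G.Adj d x) {a, b, c})
          (by rw [hC]; exact d1)
        exact fun x hx => (mem_filter.1 (this ▸ hx)).2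
      have h3 := card_cols_insert_le_of_clique (y := y) (G := G) (v := d) (X := {a, b, c})
        subset_rfl
        (by simp +contextual [hab, hab.symm, hac, hac.symm, hbc, hbc.symm]) hall
      have h4 := h3.trans (Nat.mul_le_mul_right _ (card_cols_triangle (y := y) hab hac hbc))
      rw [hC, (by omega : y + 1 - 3 = y - 2)] at h4
      have hcast := Nat.cast_le (α := ℝ).2 h4
      push_cast [Nat.cast_sub (show 1 ≤ y by omega), Nat.cast_sub (show 2 ≤ y by omega)] at hcast
      rw [hW, card_insert_of_notMem hdC, hC]
      refine hcast.trans (le_of_eq ?_)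
      field_simp
      ring
    · obtain ⟨u, v, huv, hd⟩ := card_eq_two.1 h2
      have huC := (mem_sdiff.1 (hd ▸ mem_insert_self u _)).2
      have hvC := (mem_sdiff.1 (hd ▸ mem_insert_of_mem (mem_singleton_self v))).2
      have hW : W = insert u (insert v {a, b, c}) := by
        rw [← sdiff_union_of_subset hCW, hd]; simp only [insert_union, singleton_union]
      by_cases hadj : G.Adj u v
      · have hex : ∀ w, 2 ≤ deg G {a, b, c} w → Excess y G {a, b, c} w 0 := by
          intro w hw
          obtain ⟨x, hx, x', hx', hne⟩ := one_lt_card.1 hw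
          rw [mem_filter] at hx hx'
          refine Excess.of_adj hx.1 hx'.1 ?_ hx.2 hx'.2
          have h1 := hx.1
          have h2 := hx'.1
          simp only [mem_insert, mem_singleton] at h1 h2
          rcases h1 with rfl | rfl | rfl <;> rcases h2 with rfl | rfl | rfl <;>
            first | exact absurd rfl hne | assumption | (apply G.adj_symm; assumption)
        have d1 := h.le_deg (v := u) (by rw [hW]; simp)
        have d2 := h.le_deg (v := v) (by rw [hW]; simp)
        rw [hW, deg_insert_of_not_adj G.irrefl] at d1
        rw [hW, insert_comm, deg_insert_of_not_adj G.irrefl] at d2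
        have d3 := d1.trans deg_insert_le
        have d4 := d2.trans deg_insert_le
        have h5 := card_cols_edge_le_of_excess hy hadj (hex u (by omega)) (hex v (by omega))
        have h6 := Nat.cast_le (α := ℝ).2 (card_cols_triangle (y := y) hab hac hbc)
        push_cast [Nat.cast_sub (show 1 ≤ y by omega)] at h6
        have huv' : u ∉ insert v ({a, b, c} : Finset V) := by
          rw [mem_insert, not_or]; exact ⟨huv, huC⟩
        rw [hW, card_insert_of_notMem huv', card_insert_of_notMem hvC, hC]
        have e : (y + 1) * (y - 1) * (y - 2) / y ^ 3 * (y : ℝ) ^ (3 + 1 + 1) =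
            (y * (y - 2)) * ((y + 1) * y * (y - 1)) := by
          field_simp
          ring
        rw [e]
        refine h5.trans ?_
        have h7 := mul_le_mul_of_nonneg_left h6 (show (0 : ℝ) ≤ y ^ 2 - 3 * y + 4 by nlinarith)
        have h8 := mul_le_mul_of_nonneg_right
          (show (y : ℝ) ^ 2 - 3 * y + 4 ≤ y * (y - 2) by nlinarith)
          (show (0 : ℝ) ≤ (y + 1) * y * (y - 1) from
            mul_nonneg (by positivity) (by linarith))
        linarith
      · exact hpair _ u v hCconn subset_rfl hW (by rw [mem_insert, not_or]; exact ⟨huv, huC⟩) hvC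
          hadj
  · obtain ⟨T, hCT, hTW, hT, hTc⟩ := h.conn.grow hCconn hCW 3 (by omega)
    have hdeg : ∀ {u v w}, ¬ G.Adj u v → W = insert u (insert v (insert w T)) →
        u ∉ insert v (insert w T) →
        v ∉ insert w T → w ∉ T →
        ((cols y G W).card : ℝ) ≤ (y + 1) * (y - 1) * (y - 2) / y ^ 3 * y ^ W.card := by
      intro u v w huv hW hu hv hw
      have d1 := h.le_deg (v := w) (by rw [hW]; simp)
      have d2 : deg G W w ≤ deg G T w + 2 := by
        rw [hW, insert_comm v, insert_comm u, deg_insert_of_not_adj G.irrefl]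
        have h1 := deg_insert_le (G := G) (T := insert v T) (u := u) (v := w)
        have h2 := deg_insert_le (G := G) (T := T) (u := v) (v := w)
        omega
      exact hpair (insert w T) u v (hT.insert_deg (by omega)) (hCT.trans (subset_insert _ _)) hW hu
        hv huv
    obtain ⟨u, v, w, huv, huw, hvw, hset⟩ := card_eq_three.1 hTc
    have huT := (mem_sdiff.1 (hset ▸ mem_insert_self u _)).2
    have hvT := (mem_sdiff.1 (hset ▸ mem_insert_of_mem (mem_insert_self v _))).2
    have hwT := (mem_sdiff.1 (hset ▸ mem_insert_of_mem
      (mem_insert_of_mem (mem_singleton_self w)))).2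
    have hW : W = insert u (insert v (insert w T)) := by
      rw [← sdiff_union_of_subset hTW, hset]; simp only [insert_union, singleton_union]
    by_cases h1 : G.Adj u v
    swap
    · exact hdeg h1 hW (by simp [*]) (by simp [*]) hwT
    by_cases h2 : G.Adj u w
    swap
    · exact hdeg (w := v) h2 (by rw [hW, insert_comm v]) (by simp [*]) (by simp [*, hvw.symm]) hvT
    by_cases h3 : G.Adj v w
    swap
    · exact hdeg (w := u) h3 (by rw [hW, insert_comm u v, insert_comm u w]) (by simp [*, huv.symm])
        (by simp [*, huw.symm]) huT
    have hd : ∀ {u v w}, W = insert u (insert v (insert w T)) → 1 ≤ deg G T u := by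
      intro u v w hW
      have d1 := h.le_deg (v := u) (by rw [hW]; simp)
      rw [hW, deg_insert_of_not_adj G.irrefl] at d1
      have h1 := deg_insert_le (G := G) (T := insert w T) (u := v) (v := u)
      have h2 := deg_insert_le (G := G) (T := T) (u := w) (v := u)
      omega
    have h4 := card_cols_tri_le_of_deg hy h1 h2 h3 (hd hW) (hd (u := v) (by rw [hW, insert_comm u]))
      (hd (u := w) (v := u) (w := v) (by rw [hW, insert_comm w u, insert_comm w v]))
    have h5 := good_hasTri (V := V) (y := y) (by omega) G T hT (homClosed_hasTri.mono hCtri hCT)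
    have e1 : triBound (y : ℝ) y y y ≤ y ^ 2 * (y - 2) := by
      unfold triBound; nlinarith
    have e2 : 0 ≤ triBound (y : ℝ) y y y := by
      unfold triBound; nlinarith [mul_self_nonneg ((y : ℝ) - 3),
        mul_nonneg hy0.le (mul_self_nonneg ((y : ℝ) - 2))]
    rw [← hW] at h4
    have e : (y + 1) * (y - 1) * (y - 2) / y ^ 3 * (y : ℝ) ^ W.card =
        (y ^ 2 * (y - 2)) * (((y : ℝ) ^ 2 - 1) / y ^ 2 * y ^ T.card) := by
      have : W.card = T.card + 3 := by
        rw [← hTc, add_comm, card_sdiff_add_card_eq_card hTW]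
      rw [this]
      field_simp
      ring
    rw [e]
    refine h4.trans ((mul_le_mul_of_nonneg_left h5 e2).trans (mul_le_mul_of_nonneg_right e1 ?_))
    positivity

theorem good_not_col_three (hy : 4 ≤ y) :
    Good V y ((y + 1) * (y - 1) * (y - 2) / y ^ 3) fun G W => ¬ Col 3 G W := by
  intro G W hW hcol
  obtain ⟨U, hUW, hU⟩ := exists_crit hcol
  refine card_cols_le_of_subset hW hUW hU.nonempty ?_
  by_cases htri : HasTri G U
  · obtain ⟨a, ha, b, hb, c, hc, hab, hac, hbc⟩ := htri
    exact hU.card_cols_le_of_triangle hy ha hb hc hab hac hbc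
  · exact hU.card_cols_le_of_triangleFree hy htri

end FiveCrit

namespace FiveCrit

variable {V : Type} {y : ℕ} {G : SimpleGraph V} {T : Finset V} {K : ℝ} {a b c d e : V}

theorem deg_insert {u v : V} (hu : u ∉ T) :
    deg G (insert u T) v = deg G T v + if G.Adj v u then 1 else 0 := by
  split_ifs with h
  · exact deg_insert_of_adj hu h
  · exact deg_insert_of_not_adj h

variable [Fintype V]

/-- All but the five vertices `a, b, c, d, e` lie in the connected set `T`, and extending `T` by `n`
vertices to a connected set multiplies the bound `K` on the number of its colourings by `y ^ n`. -/
structure Frame (y : ℕ) (G : SimpleGraph V) (T : Finset V) (K : ℝ) (a b c d e : V) : Prop where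
  nodup : [a, b, c, d, e].Nodup
  mem_iff : ∀ x, x ∈ [a, b, c, d, e] ↔ x ∉ T
  four_le_deg : ∀ x ∉ T, 4 ≤ deg G univ x
  conn : Conn G T
  spread : ∀ U n, T ⊆ U → U.card = T.card + n → Conn G U → Spread y G U (K * y ^ n)

namespace Frame

theorem perm {a' b' c' d' e' : V} (h : Frame y G T K a b c d e)
    (hp : [a', b', c', d', e'].Perm [a, b, c, d, e]) : Frame y G T K a' b' c' d' e' where
  nodup := hp.nodup_iff.2 h.nodup
  mem_iff x := hp.mem_iff.trans (h.mem_iff x)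
  four_le_deg := h.four_le_deg
  conn := h.conn
  spread := h.spread

theorem swap₁ (h : Frame y G T K a b c d e) : Frame y G T K b a c d e := h.perm (.swap ..)

theorem swap₂ (h : Frame y G T K a b c d e) : Frame y G T K a c b d e :=
  h.perm (.cons _ (.swap ..))

theorem swap₃ (h : Frame y G T K a b c d e) : Frame y G T K a b d c e :=
  h.perm (.cons _ (.cons _ (.swap ..)))

theorem swap₄ (h : Frame y G T K a b c d e) : Frame y G T K a b c e d :=
  h.perm (.cons _ (.cons _ (.cons _ (.swap ..))))

theorem rotate (h : Frame y G T K a b c d e) : Frame y G T K b c d e a :=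
  h.swap₁.swap₂.swap₃.swap₄

theorem ne (h : Frame y G T K a b c d e) : (a ≠ b ∧ a ≠ c ∧ a ≠ d ∧ a ≠ e) ∧
    (b ≠ c ∧ b ≠ d ∧ b ≠ e) ∧ (c ≠ d ∧ c ≠ e) ∧ d ≠ e := by
  simpa [not_or] using h.nodup

theorem notMem (h : Frame y G T K a b c d e) : a ∉ T := (h.mem_iff a).1 (by simp)

theorem univ_eq (h : Frame y G T K a b c d e) :
    univ = insert a (insert b (insert c (insert d (insert e T)))) := by
  ext x
  have := h.mem_iff x
  simp only [List.mem_cons, List.not_mem_nil, or_false] at this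
  simp only [mem_univ, mem_insert, true_iff]
  tauto

theorem card_insert (h : Frame y G T K a b c d e) : (insert e T).card = T.card + 1 :=
  card_insert_of_notMem h.rotate.rotate.rotate.rotate.notMem

theorem notMem_insert (h : Frame y G T K a b c d e) : d ∉ insert e T := by
  have := h.rotate.rotate.rotate.notMem
  have := h.ne
  simp only [mem_insert]
  tauto

theorem card_insert_insert (h : Frame y G T K a b c d e) :
    (insert d (insert e T)).card = T.card + 2 := by
  rw [card_insert_of_notMem h.notMem_insert, h.card_insert]

theorem deg_insert_insert (h : Frame y G T K a b c d e) (x : V) :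
    deg G (insert d (insert e T)) x =
      deg G T x + (if G.Adj x e then 1 else 0) + if G.Adj x d then 1 else 0 := by
  rw [deg_insert h.notMem_insert, deg_insert h.rotate.rotate.rotate.rotate.notMem]

theorem four_le (h : Frame y G T K a b c d e) :
    4 ≤ deg G T a + (if G.Adj a b then 1 else 0) + (if G.Adj a c then 1 else 0) +
      (if G.Adj a d then 1 else 0) + if G.Adj a e then 1 else 0 := by
  have h1 := h.four_le_deg a h.notMem
  have hne := h.ne
  rw [h.univ_eq, deg_insert_of_not_adj G.irrefl, deg_insert, deg_insert, h.deg_insert_insert] at h1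
  · omega
  · have := h.rotate.rotate.notMem
    simp only [mem_insert]
    tauto
  · have := h.rotate.notMem
    simp only [mem_insert]
    tauto

theorem spread₀ (h : Frame y G T K a b c d e) : Spread y G T K := by
  simpa using h.spread T 0 subset_rfl rfl h.conn

theorem spread₂ (h : Frame y G T K a b c d e) (hc : Conn G (insert d (insert e T))) :
    Spread y G (insert d (insert e T)) (K * y ^ 2) :=
  h.spread _ 2 ((subset_insert _ _).trans (subset_insert _ _)) h.card_insert_insert hc

theorem conn₂ (h : Frame y G T K a b c d e) (hd : 1 ≤ deg G T d) (he : 1 ≤ deg G T e) :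
    Conn G (insert d (insert e T)) :=
  (h.conn.insert_deg he).insert_deg (hd.trans (deg_mono (subset_insert _ _)))

theorem card_cols_le_of_excess (h : Frame y G T K a b c d e) (hy : 4 ≤ y) (hab : G.Adj a b)
    (hac : G.Adj a c) (hbc : G.Adj b c) {A B C : ℝ}
    (ha : Excess y G (insert d (insert e T)) a A) (hb : Excess y G (insert d (insert e T)) b B)
    (hc : Excess y G (insert d (insert e T)) c C)
    (hN : ((cols y G (insert d (insert e T))).card : ℝ) ≤ y * (y - 1) * K ∧ A + B + C ≤ 3 * y * K ∨
      ((cols y G (insert d (insert e T))).card : ℝ) ≤ (y ^ 2 - y + 1) * K ∧ A + B + C ≤ 2 * y * K) :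
    ((cols y G univ).card : ℝ) ≤ y ^ 4 * (y - 3) * K := by
  have h1 := card_cols_tri_le_of_excess hy hab hac hbc ha hb hc
  rw [← h.univ_eq] at h1
  refine h1.trans ?_
  have hK := h.spread₀.nonneg
  have hy' : (4 : ℝ) ≤ y := by exact_mod_cast hy
  obtain ⟨z, hz⟩ : ∃ z : ℝ, z = y - 4 := ⟨_, rfl⟩
  have hz0 : 0 ≤ z := by rw [hz]; linarith
  have hyz : (y : ℝ) = z + 4 := by rw [hz]; ring
  have e1 : (0 : ℝ) ≤ triBound y (y - 1) (y - 1) (y - 1) := by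
    unfold triBound; rw [hyz]; ring_nf; positivity
  have e2 : (0 : ℝ) ≤ (triBound y y y y - triBound y (y - 1) (y - 1) (y - 1)) / 3 := by
    unfold triBound; rw [hyz]; ring_nf; positivity
  rcases hN with ⟨hN, hE⟩ | ⟨hN, hE⟩
  · have e3 : (0 : ℝ) ≤ y ^ 4 * (y - 3) - triBound y (y - 1) (y - 1) (y - 1) * (y * (y - 1)) -
        (triBound y y y y - triBound y (y - 1) (y - 1) (y - 1)) / 3 * (3 * y) := by
      unfold triBound; rw [hyz]; ring_nf; positivity
    linarith [mul_le_mul_of_nonneg_left hN e1, mul_le_mul_of_nonneg_left hE e2, mul_nonneg e3 hK]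
  · have e3 : (0 : ℝ) ≤ y ^ 4 * (y - 3) - triBound y (y - 1) (y - 1) (y - 1) * (y ^ 2 - y + 1) -
        (triBound y y y y - triBound y (y - 1) (y - 1) (y - 1)) / 3 * (2 * y) := by
      unfold triBound; rw [hyz]; ring_nf; positivity
    linarith [mul_le_mul_of_nonneg_left hN e1, mul_le_mul_of_nonneg_left hE e2, mul_nonneg e3 hK]

theorem excess (h : Frame y G T K a b c d e) (hy : 4 ≤ y)
    (hconn : Conn G (insert d (insert e T))) {x : V} (hx : 2 ≤ deg G (insert d (insert e T)) x) :
    Excess y G (insert d (insert e T)) x (y * K) := by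
  have := (h.spread₂ hconn).excess (by omega) hx
  convert this using 1
  have : (0 : ℝ) < y := by exact_mod_cast (by omega : 0 < y)
  field_simp

theorem two_le_deg (h : Frame y G T K a b c d e) : 2 ≤ deg G (insert d (insert e T)) a := by
  have := h.four_le
  rw [h.deg_insert_insert]
  split_ifs at this ⊢ <;> omega

theorem card_cols_le_of_card_le (h : Frame y G T K a b c d e) (hy : 4 ≤ y) (hab : G.Adj a b)
    (hac : G.Adj a c) (hbc : G.Adj b c) (hconn : Conn G (insert d (insert e T)))
    (hN : ((cols y G (insert d (insert e T))).card : ℝ) ≤ y * (y - 1) * K) :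
    ((cols y G univ).card : ℝ) ≤ y ^ 4 * (y - 3) * K :=
  h.card_cols_le_of_excess hy hab hac hbc (h.excess hy hconn h.two_le_deg)
    (h.excess hy hconn h.swap₁.two_le_deg) (h.excess hy hconn h.swap₂.swap₁.two_le_deg)
    (Or.inl ⟨hN, by linarith⟩)

theorem card_cols_le_of_common (h : Frame y G T K a b c d e) (hy : 4 ≤ y) (hab : G.Adj a b)
    (hac : G.Adj a c) (hbc : G.Adj b c) (hconn : Conn G (insert d (insert e T))) (hde : G.Adj d e)
    (hN : ((cols y G (insert d (insert e T))).card : ℝ) ≤ (y ^ 2 - y + 1) * K)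
    (hcom : (G.Adj a d ∧ G.Adj a e) ∨ (G.Adj b d ∧ G.Adj b e) ∨ (G.Adj c d ∧ G.Adj c e)) :
    ((cols y G univ).card : ℝ) ≤ y ^ 4 * (y - 3) * K := by
  have ha := h.excess hy hconn h.two_le_deg
  have hb := h.excess hy hconn h.swap₁.two_le_deg
  have hc := h.excess hy hconn h.swap₂.swap₁.two_le_deg
  have hex : ∀ {x}, G.Adj x d ∧ G.Adj x e → Excess y G (insert d (insert e T)) x 0 := fun hx =>
    Excess.of_adj (by simp) (by simp) hde hx.1 hx.2
  rcases hcom with hx | hx | hx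
  · exact h.card_cols_le_of_excess hy hab hac hbc (hex hx) hb hc (Or.inr ⟨hN, by linarith⟩)
  · exact h.card_cols_le_of_excess hy hab hac hbc ha (hex hx) hc (Or.inr ⟨hN, by linarith⟩)
  · exact h.card_cols_le_of_excess hy hab hac hbc ha hb (hex hx) (Or.inr ⟨hN, by linarith⟩)

end Frame

end FiveCrit

namespace FiveCrit

variable {V : Type} [Fintype V] {y : ℕ} {G : SimpleGraph V} {T : Finset V} {K : ℝ}
  {a b c d e u v : V}

theorem Spread.card_cols_edge_le (hS : Spread y G T K) (hy : 4 ≤ y) (huv : G.Adj u v)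
    (hu : 2 ≤ deg G T u) (hv : 1 ≤ deg G T v) :
    ((cols y G (insert u (insert v T))).card : ℝ) ≤ y * (y - 1) * K := by
  obtain ⟨ε, h01, l1, s1⟩ := hS.excess (by omega) hu
  have hcast := Nat.cast_le (α := ℝ).2 (FiveCrit.card_cols_edge_le (y := y) (T := T) huv)
  rw [Nat.cast_sum] at hcast
  have hy' : (4 : ℝ) ≤ y := by exact_mod_cast hy
  have hle : ∀ f ∈ cols y G T, ((edgeSet (avail G T f u) (avail G T f v)).card : ℝ) ≤
      (y ^ 2 - 2 * y + 2) + (y - 1) * ε f := by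
    intro f hf
    refine (card_edgeSet_le (l1 f hf) (card_avail_le_of_deg hv) (by omega) (by omega)).trans ?_
    push_cast [Nat.cast_sub (show 1 ≤ y by omega)]
    linarith
  refine hcast.trans ((sum_le_sum hle).trans ?_)
  rw [sum_add_distrib, sum_const, nsmul_eq_mul, ← mul_sum]
  have hpos : (0 : ℝ) < y := by linarith
  rw [le_div_iff₀ hpos] at s1
  refine le_of_mul_le_mul_right ?_ hpos
  have h1 := mul_le_mul_of_nonneg_left s1 (show (0 : ℝ) ≤ y - 1 by linarith)
  have h2 := mul_le_mul_of_nonneg_left hS.total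
    (show (0 : ℝ) ≤ y * (y ^ 2 - 2 * y + 2) from mul_nonneg hpos.le (by nlinarith))
  have h3 := mul_nonneg hS.nonneg (show (0 : ℝ) ≤ y ^ 2 - 3 * y + 1 by nlinarith)
  linarith

theorem card_cols_edge_le_of_deg (huv : G.Adj u v) (hy : 4 ≤ y) (hu : 1 ≤ deg G T u)
    (hv : 1 ≤ deg G T v) :
    ((cols y G (insert u (insert v T))).card : ℝ) ≤ (y ^ 2 - y + 1) * (cols y G T).card := by
  have hcast := Nat.cast_le (α := ℝ).2 (card_cols_edge_le (y := y) (T := T) huv)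
  rw [Nat.cast_sum] at hcast
  refine hcast.trans ((sum_le_sum fun f hf => card_edgeSet_le (card_avail_le_of_deg hu)
    (card_avail_le_of_deg hv) (by omega) (by omega)).trans (le_of_eq ?_))
  rw [sum_const, nsmul_eq_mul]
  ring

theorem Spread.card_cols_pair_le_of_two (hS : Spread y G T K) (hy : 4 ≤ y) (hu : 2 ≤ deg G T u)
    (hv : 2 ≤ deg G T v) :
    ((cols y G (insert u (insert v T))).card : ℝ) ≤ y * (y - 1) * K := by
  obtain ⟨ε₁, h1, l1, s1⟩ := hS.excess (by omega) hu
  obtain ⟨ε₂, h2, l2, s2⟩ := hS.excess (by omega) hv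
  have hcast := Nat.cast_le (α := ℝ).2 (card_cols_pair_le_prod (y := y) (G := G) (T := T)
    (u := u) (v := v))
  push_cast at hcast
  have hy' : (4 : ℝ) ≤ y := by exact_mod_cast hy
  have hle : ∀ f ∈ cols y G T, ((avail G T f u).card * (avail G T f v).card : ℝ) ≤
      (y - 1) ^ 2 + (y - 1 / 2) * (ε₁ f + ε₂ f) := by
    intro f hf
    have a1 := Nat.cast_le (α := ℝ).2 (l1 f hf)
    have a2 := Nat.cast_le (α := ℝ).2 (l2 f hf)
    refine (mul_le_mul a1 a2 (Nat.cast_nonneg _) (Nat.cast_nonneg _)).trans ?_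
    push_cast [Nat.cast_sub (show 1 ≤ y by omega)]
    rcases h1 f with h1 | h1 <;> rcases h2 f with h2 | h2 <;> rw [h1, h2] <;> push_cast <;>
      nlinarith
  refine hcast.trans ((sum_le_sum hle).trans ?_)
  rw [sum_add_distrib, sum_const, nsmul_eq_mul, ← mul_sum, sum_add_distrib]
  have hpos : (0 : ℝ) < y := by linarith
  rw [le_div_iff₀ hpos] at s1 s2
  refine le_of_mul_le_mul_right ?_ hpos
  have h1 := mul_le_mul_of_nonneg_left (add_le_add s1 s2) (show (0 : ℝ) ≤ y - 1 / 2 by linarith)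
  have h2 := mul_le_mul_of_nonneg_left hS.total
    (show (0 : ℝ) ≤ y * (y - 1) ^ 2 by positivity)
  have h3 := mul_nonneg hS.nonneg (show (0 : ℝ) ≤ y ^ 2 - 3 * y + 1 by nlinarith)
  linarith

theorem Spread.card_cols_insert_insert_le_of_three (hS : Spread y G T K) (hy : 4 ≤ y)
    (hu : 3 ≤ deg G T u) (hv : 1 ≤ deg G (insert u T) v) :
    ((cols y G (insert v (insert u T))).card : ℝ) ≤ y * (y - 1) * K := by
  obtain ⟨ε, l1, -, s1⟩ := hS.excess_three (by omega) hu
  obtain ⟨x, hx, hvx⟩ := exists_adj_of_deg hv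
  have hstep := Nat.cast_le (α := ℝ).2 (card_cols_insert_le (y := y) hx hvx.symm)
  have hcast := Nat.cast_le (α := ℝ).2 (card_cols_insert_le_sum (y := y) (G := G) (T := T) (v := u))
  push_cast at hcast hstep
  have hy' : (4 : ℝ) ≤ y := by exact_mod_cast hy
  have hpos : (0 : ℝ) < y := by linarith
  have h1 := hcast.trans (sum_le_sum fun f _ => l1 f)
  rw [sum_add_distrib, sum_const, nsmul_eq_mul] at h1
  have h2 := mul_le_mul_of_nonneg_left hS.total
    (show (0 : ℝ) ≤ y * (y - 2) from mul_nonneg hpos.le (by linarith))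
  have h3 := mul_le_mul_of_nonneg_right h1 hpos.le
  have h4 := mul_nonneg hS.nonneg (show (0 : ℝ) ≤ y - 3 by linarith)
  linarith

theorem Spread.card_cols_insert_insert_le_of_two (hS : Spread y G T K) (hy : 4 ≤ y)
    (hu : 2 ≤ deg G T u) (hv : 1 ≤ deg G (insert u T) v) :
    ((cols y G (insert v (insert u T))).card : ℝ) ≤ (y ^ 2 - y + 1) * K := by
  obtain ⟨ε, -, l1, s1⟩ := hS.excess (by omega) hu
  obtain ⟨x, hx, hvx⟩ := exists_adj_of_deg hv
  have hstep := Nat.cast_le (α := ℝ).2 (card_cols_insert_le (y := y) hx hvx.symm)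
  have hcast := (card_cols_insert_le_sum (y := y) (G := G) (T := T) (v := u)).trans (sum_le_sum l1)
  have hcast := Nat.cast_le (α := ℝ).2 hcast
  rw [sum_add_distrib, sum_const, smul_eq_mul] at hcast
  push_cast [Nat.cast_sub (show 1 ≤ y by omega)] at hcast hstep
  have hy' : (4 : ℝ) ≤ y := by exact_mod_cast hy
  have hpos : (0 : ℝ) < y := by linarith
  rw [le_div_iff₀ hpos] at s1
  have h2 := mul_le_mul_of_nonneg_left hS.total
    (show (0 : ℝ) ≤ y * (y - 1) from mul_nonneg hpos.le (by linarith))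
  have h3 := mul_le_mul_of_nonneg_right hcast hpos.le
  linarith

namespace Frame

/-- The five vertices induce a complete graph or a complete graph without the edge `cd`. -/
theorem card_cols_le_of_almost_complete (h : Frame y G T K a b c d e) (hy : 4 ≤ y) (hab : G.Adj a b)
    (hac : G.Adj a c) (hbc : G.Adj b c) (hea : G.Adj e a) (heb : G.Adj e b) (hec : G.Adj e c)
    (hed : G.Adj e d) (hda : G.Adj d a) (hdb : G.Adj d b) :
    ((cols y G univ).card : ℝ) ≤ y ^ 4 * (y - 3) * K := by
  have h1 := card_cols_insert_le_of_clique (y := y) (G := G) (T := T) (v := e) (empty_subset _)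
    (by simp) (by simp)
  have h2 := card_cols_insert_le_of_clique (y := y) (G := G) (T := insert e T) (v := a) (X := {e})
    (by simp) (by simp) (by simp [hea.symm])
  have h3 := card_cols_insert_le_of_clique (y := y) (G := G) (T := insert a (insert e T)) (v := b)
    (X := {a, e}) (by simp [insert_subset_iff]) (by simp +contextual [hea, hea.symm])
    (by simp [hab.symm, heb.symm])
  have hcl : ∀ u ∈ ({b, a, e} : Finset V), ∀ v ∈ ({b, a, e} : Finset V), u ≠ v → G.Adj u v := by
    simp +contextual [hab, hab.symm, hea, hea.symm, heb, heb.symm]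
  have h4 := card_cols_insert_le_of_clique (y := y) (G := G) (T := insert b (insert a (insert e T)))
    (v := c) (by simp [insert_subset_iff]) hcl (by simp [hac.symm, hbc.symm, hec.symm])
  have h5 := card_cols_insert_le_of_clique (y := y) (G := G)
    (T := insert c (insert b (insert a (insert e T))))
    (v := d) (by simp [insert_subset_iff]) hcl (by simp [hda, hdb, hed.symm])
  have hcard : ({b, a, e} : Finset V).card = 3 := by
    rw [card_insert_of_notMem, card_pair hea.ne']
    simp [hab.ne', heb.ne']
  rw [hcard] at h4 h5
  rw [card_pair hea.ne'] at h3
  rw [card_singleton] at h2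
  rw [card_empty] at h1
  have hu : univ = insert d (insert c (insert b (insert a (insert e T)))) := by
    rw [h.univ_eq]; ext; simp; tauto
  rw [← hu] at h5
  have h6 : (cols y G univ).card ≤
      (cols y G T).card * (y + 1) * y * (y - 1) * (y - 2) * (y - 2) := by
    refine h5.trans (Nat.mul_le_mul (h4.trans (Nat.mul_le_mul (h3.trans (Nat.mul_le_mul
      (h2.trans (Nat.mul_le_mul (h1.trans_eq rfl) ?_)) ?_)) ?_)) ?_) <;> omega
  have h7 := Nat.cast_le (α := ℝ).2 h6
  push_cast [Nat.cast_sub (show 1 ≤ y by omega), Nat.cast_sub (show 2 ≤ y by omega)] at h7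
  refine h7.trans ?_
  have hy' : (4 : ℝ) ≤ y := by exact_mod_cast hy
  obtain ⟨z, hz⟩ : ∃ z : ℝ, z = y - 4 := ⟨_, rfl⟩
  have hz0 : 0 ≤ z := by rw [hz]; linarith
  have hyz : (y : ℝ) = z + 4 := by rw [hz]; ring
  have e1 : (0 : ℝ) ≤ (y + 1) * y * (y - 1) * (y - 2) * (y - 2) := by
    rw [hyz]; ring_nf; positivity
  have e2 : (0 : ℝ) ≤ y ^ 4 * (y - 3) - (y + 1) * y * (y - 1) * (y - 2) * (y - 2) := by
    rw [hyz]; ring_nf; positivity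
  linarith [mul_le_mul_of_nonneg_left h.spread₀.total e1, mul_nonneg e2 h.spread₀.nonneg]

theorem card_cols_le_of_deg_eq_zero (h : Frame y G T K a b c d e) (hy : 4 ≤ y) (hab : G.Adj a b)
    (hac : G.Adj a c) (hbc : G.Adj b c) (he : deg G T e = 0) :
    ((cols y G univ).card : ℝ) ≤ y ^ 4 * (y - 3) * K := by
  have he4 := h.rotate.rotate.rotate.rotate.four_le
  have hd4 := h.rotate.rotate.rotate.four_le
  obtain ⟨hea, heb, hec, hed⟩ : G.Adj e a ∧ G.Adj e b ∧ G.Adj e c ∧ G.Adj e d := by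
    refine ⟨?_, ?_, ?_, ?_⟩ <;> by_contra hc <;> rw [if_neg hc] at he4 <;>
      split_ifs at he4 <;> omega
  have hed1 : 1 ≤ deg G (insert d T) e := by
    rw [deg_insert_of_adj h.rotate.rotate.rotate.notMem hed]
    omega
  rcases le_or_gt (deg G T d) 1 with hd1 | hd2
  · rw [if_pos hed.symm] at hd4
    by_cases hda : G.Adj d a
    · by_cases hdb : G.Adj d b
      · exact h.card_cols_le_of_almost_complete hy hab hac hbc hea heb hec hed hda hdb
      · rw [if_neg hdb] at hd4
        have hdc : G.Adj d c := by
          by_contra hc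
          rw [if_neg hc] at hd4
          split_ifs at hd4
          omega
        exact h.swap₂.card_cols_le_of_almost_complete hy hac hab hbc.symm hea hec heb hed hda hdc
    · rw [if_neg hda] at hd4
      obtain ⟨hdb, hdc⟩ : G.Adj d b ∧ G.Adj d c := by
        refine ⟨?_, ?_⟩ <;> by_contra hc <;> rw [if_neg hc] at hd4 <;> split_ifs at hd4 <;> omega
      exact h.swap₁.swap₂.card_cols_le_of_almost_complete hy hbc hab.symm hac.symm heb hec hea hed
        hdb hdc
  · have hconn : Conn G (insert d (insert e T)) := by
      rw [insert_comm]
      exact (h.conn.insert_deg (by omega)).insert_deg hed1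
    rcases (by omega : 3 ≤ deg G T d ∨ deg G T d = 2) with hd | hd
    · refine h.card_cols_le_of_card_le hy hab hac hbc hconn ?_
      rw [insert_comm]
      exact h.spread₀.card_cols_insert_insert_le_of_three hy hd hed1
    · refine h.card_cols_le_of_common hy hab hac hbc hconn hed.symm ?_ ?_
      · rw [insert_comm]
        exact h.spread₀.card_cols_insert_insert_le_of_two hy hd2 hed1
      · rw [hd, if_pos hed.symm] at hd4
        simp only [hea.symm, heb.symm, hec.symm, and_true, G.adj_comm _ d]
        by_contra! hc
        simp [hc.1, hc.2.1, hc.2.2] at hd4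

theorem card_cols_le_of_triangle_of_edge (h : Frame y G T K a b c d e) (hy : 4 ≤ y)
    (hab : G.Adj a b) (hac : G.Adj a c) (hbc : G.Adj b c) (hde : G.Adj d e) :
    ((cols y G univ).card : ℝ) ≤ y ^ 4 * (y - 3) * K := by
  rcases Nat.eq_zero_or_pos (deg G T e) with he | he
  · exact h.card_cols_le_of_deg_eq_zero hy hab hac hbc he
  rcases Nat.eq_zero_or_pos (deg G T d) with hd | hd
  · exact h.swap₄.card_cols_le_of_deg_eq_zero hy hab hac hbc hd
  have hconn := h.conn₂ hd he
  rcases Nat.lt_or_ge 1 (deg G T d) with hd2 | hd1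
  · exact h.card_cols_le_of_card_le hy hab hac hbc hconn
      (h.spread₀.card_cols_edge_le hy hde hd2 he)
  rcases Nat.lt_or_ge 1 (deg G T e) with he2 | he1
  · refine h.card_cols_le_of_card_le hy hab hac hbc hconn ?_
    rw [insert_comm]
    exact h.spread₀.card_cols_edge_le hy hde.symm he2 hd
  refine h.card_cols_le_of_common hy hab hac hbc hconn hde ?_ ?_
  · refine (card_cols_edge_le_of_deg hde hy hd he).trans
      (mul_le_mul_of_nonneg_left h.spread₀.total ?_)
    nlinarith [sq_nonneg ((y : ℝ) - 1)]
  · have he4 := h.rotate.rotate.rotate.rotate.four_le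
    have hd4 := h.rotate.rotate.rotate.four_le
    simp only [G.adj_comm d a, G.adj_comm d b, G.adj_comm d c, G.adj_comm e a, G.adj_comm e b,
      G.adj_comm e c] at he4 hd4
    by_contra! hc
    obtain ⟨ha, hb, hc⟩ := hc
    split_ifs at he4 hd4 <;> first | omega | tauto

theorem card_cols_le_of_triangle (h : Frame y G T K a b c d e) (hy : 4 ≤ y)
    (hab : G.Adj a b) (hac : G.Adj a c) (hbc : G.Adj b c) :
    ((cols y G univ).card : ℝ) ≤ y ^ 4 * (y - 3) * K := by
  by_cases hde : G.Adj d e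
  · exact h.card_cols_le_of_triangle_of_edge hy hab hac hbc hde
  have he4 := h.rotate.rotate.rotate.rotate.four_le
  have hd4 := h.rotate.rotate.rotate.four_le
  rw [if_neg hde] at hd4
  rw [if_neg fun h => hde (G.adj_symm h)] at he4
  have hd : 1 ≤ deg G T d := by split_ifs at hd4 <;> omega
  have he : 1 ≤ deg G T e := by split_ifs at he4 <;> omega
  have hconn := h.conn₂ hd he
  -- exchange `d` with a vertex of the triangle
  have key : ∀ {d e}, Frame y G T K a b c d e → ¬ G.Adj d e → deg G T d = 1 → deg G T e ≤ 2 →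
      ((cols y G univ).card : ℝ) ≤ y ^ 4 * (y - 3) * K := by
    intro d e h hde hd he
    have he4 := h.rotate.rotate.rotate.rotate.four_le
    have hd4 := h.rotate.rotate.rotate.four_le
    rw [if_neg hde] at hd4
    rw [if_neg fun h => hde (G.adj_symm h)] at he4
    obtain ⟨hda, hdb, hdc⟩ : G.Adj d a ∧ G.Adj d b ∧ G.Adj d c := by
      refine ⟨?_, ?_, ?_⟩ <;> by_contra hc <;> rw [if_neg hc] at hd4 <;>
        split_ifs at hd4 <;> omega
    by_cases hea : G.Adj e a
    · exact h.swap₃.swap₂.swap₁.swap₂.swap₃.card_cols_le_of_triangle_of_edge hy hdb hdc hbc hea.symm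
    · have heb : G.Adj e b := by
        by_contra hc
        rw [if_neg hc, if_neg hea] at he4
        split_ifs at he4 <;> omega
      exact h.swap₁.swap₃.swap₂.swap₁.swap₂.swap₃.card_cols_le_of_triangle_of_edge hy hda hdc hac
        heb.symm
  rcases Nat.lt_or_ge 2 (deg G T d) with hd3 | hd2
  · refine h.card_cols_le_of_card_le hy hab hac hbc hconn ?_
    rw [insert_comm]
    exact h.spread₀.card_cols_insert_insert_le_of_three hy hd3
      (he.trans (deg_mono (subset_insert _ _)))
  rcases Nat.lt_or_ge 2 (deg G T e) with he3 | he2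
  · exact h.card_cols_le_of_card_le hy hab hac hbc hconn
      (h.spread₀.card_cols_insert_insert_le_of_three hy he3
        (hd.trans (deg_mono (subset_insert _ _))))
  rcases Nat.lt_or_ge 1 (deg G T d) with hd2' | hd1
  · rcases Nat.lt_or_ge 1 (deg G T e) with he2' | he1
    · exact h.card_cols_le_of_card_le hy hab hac hbc hconn
        (h.spread₀.card_cols_pair_le_of_two hy hd2' he2')
    · exact key h.swap₄ (fun h => hde (G.adj_symm h)) (by omega) hd2
  · exact key h hde (by omega) he2

end Frame

end FiveCrit

namespace FiveCrit

theorem card_four_cases {α : Type} [DecidableEq α] (p q r s : α) {k A B C : ℕ}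
    (hk : k = ({p, q, r, s} : Finset α).card)
    (hA : A = (if p = q then 1 else 0) + (if p = r then 1 else 0) + (if p = s then 1 else 0) +
          (if q = r then 1 else 0) + (if q = s then 1 else 0) + (if r = s then 1 else 0))
    (hB : B = (if p = q ∧ r = s then 1 else 0) + (if p = r ∧ q = s then 1 else 0) +
          (if p = s ∧ q = r then 1 else 0))
    (hC : C = (if p = q ∧ p = r then 1 else 0) + (if p = q ∧ p = s then 1 else 0) +
          (if p = r ∧ p = s then 1 else 0) + (if q = r ∧ q = s then 1 else 0)) :
    k = 4 ∧ A = 0 ∧ B = 0 ∧ C = 0 ∨ k = 3 ∧ A = 1 ∧ B = 0 ∧ C = 0 ∨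
      k = 2 ∧ A = 2 ∧ B = 1 ∧ C = 0 ∨ k = 2 ∧ A = 3 ∧ B = 0 ∧ C = 1 ∨
      k = 1 ∧ A = 6 ∧ B = 3 ∧ C = 4 := by
  by_cases h1 : p = q <;> by_cases h2 : p = r <;> by_cases h3 : p = s <;>
    by_cases h4 : q = r <;> by_cases h5 : q = s <;> by_cases h6 : r = s <;>
    simp_all

variable {V : Type} [Fintype V] {y : ℕ} {G : SimpleGraph V} {T : Finset V} {K : ℝ}
  {a b c d e u v : V}

theorem cube_card_avail_le (hy : 4 ≤ y) {f : V → Fin (y + 1)} {x₁ x₂ x₃ x₄ : V}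
    (hX : {x₁, x₂, x₃, x₄} ⊆ T) (hv : ∀ x ∈ ({x₁, x₂, x₃, x₄} : Finset V), G.Adj v x) :
    ((avail G T f v).card : ℝ) ^ 3 ≤ (y - 3) ^ 3 + (3 * y ^ 2 - 15 * y + 19) *
        ((if f x₁ = f x₂ then 1 else 0) + (if f x₁ = f x₃ then 1 else 0) +
          (if f x₁ = f x₄ then 1 else 0) + (if f x₂ = f x₃ then 1 else 0) +
          (if f x₂ = f x₄ then 1 else 0) + (if f x₃ = f x₄ then 1 else 0)) +
      6 * (y - 2) * ((if f x₁ = f x₂ ∧ f x₃ = f x₄ then 1 else 0) +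
          (if f x₁ = f x₃ ∧ f x₂ = f x₄ then 1 else 0) +
          (if f x₁ = f x₄ ∧ f x₂ = f x₃ then 1 else 0)) +
      5 * ((if f x₁ = f x₂ ∧ f x₁ = f x₃ then 1 else 0) +
          (if f x₁ = f x₂ ∧ f x₁ = f x₄ then 1 else 0) +
          (if f x₁ = f x₃ ∧ f x₁ = f x₄ then 1 else 0) +
          (if f x₂ = f x₃ ∧ f x₂ = f x₄ then 1 else 0)) := by
  have hm := card_avail_le_of_subset (f := f) hX hv
  simp only [image_insert, image_singleton] at hm
  have h := card_four_cases (f x₁) (f x₂) (f x₃) (f x₄) rfl rfl rfl rfl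
  generalize (avail G T f v).card = m at hm ⊢
  generalize ({f x₁, f x₂, f x₃, f x₄} : Finset (Fin (y + 1))).card = k at hm h
  have hy' : (4 : ℝ) ≤ y := by exact_mod_cast hy
  have hcube : (m : ℝ) ^ 3 ≤ (y + 1 - k) ^ 3 := by
    have : (m : ℝ) + k ≤ y + 1 := by exact_mod_cast hm
    exact pow_le_pow_left₀ (Nat.cast_nonneg _) (by linarith) 3
  refine hcube.trans ?_
  rcases h with ⟨hk, hA, hB, hC⟩ | ⟨hk, hA, hB, hC⟩ | ⟨hk, hA, hB, hC⟩ | ⟨hk, hA, hB, hC⟩ |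
    ⟨hk, hA, hB, hC⟩ <;>
  · replace hA := congrArg (Nat.cast (R := ℝ)) hA
    replace hB := congrArg (Nat.cast (R := ℝ)) hB
    replace hC := congrArg (Nat.cast (R := ℝ)) hC
    push_cast at hA hB hC
    rw [hk, hA, hB, hC]
    push_cast
    nlinarith [mul_nonneg (sub_nonneg.2 hy') (sub_nonneg.2 hy')]

theorem Spread.sum_cube_card_avail_le (hS : Spread y G T K) (hy : 4 ≤ y) (h : 4 ≤ deg G T v) :
    ∑ f ∈ cols y G T, ((avail G T f v).card : ℝ) ^ 3 ≤ y ^ 2 * (y - 3) * K := by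
  obtain ⟨X, hX, hXc⟩ := exists_subset_card_eq h
  obtain ⟨x₁, x₂, x₃, x₄, h12, h13, h14, h23, h24, h34, rfl⟩ := card_eq_four.1 hXc
  have hXT := hX.trans (filter_subset _ _)
  have m1 : x₁ ∈ T := hXT (by simp)
  have m2 : x₂ ∈ T := hXT (by simp)
  have m3 : x₃ ∈ T := hXT (by simp)
  have m4 : x₄ ∈ T := hXT (by simp)
  refine (sum_le_sum fun f _ => cube_card_avail_le (f := f) hy hXT
    fun x hx => (mem_filter.1 (hX hx)).2).trans ?_
  have p1 := hS.sum_pair m1 m2 h12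
  have p2 := hS.sum_pair m1 m3 h13
  have p3 := hS.sum_pair m1 m4 h14
  have p4 := hS.sum_pair m2 m3 h23
  have p5 := hS.sum_pair m2 m4 h24
  have p6 := hS.sum_pair m3 m4 h34
  have q1 := hS.sum_two m1 m2 m3 m4 h12 h34 (by simp [*])
  have q2 := hS.sum_two m1 m3 m2 m4 h13 h24 (by simp [*])
  have q3 := hS.sum_two m1 m4 m2 m3 h14 h23 (by simp [*])
  have r1 := hS.sum_two m1 m2 m1 m3 h12 h13 (by simp [*])
  have r2 := hS.sum_two m1 m2 m1 m4 h12 h14 (by simp [*])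
  have r3 := hS.sum_two m1 m3 m1 m4 h13 h14 (by simp [*])
  have r4 := hS.sum_two m2 m3 m2 m4 h23 h24 (by simp [*])
  simp only [sum_add_distrib, ← mul_sum, sum_const, nsmul_eq_mul]
  have hK := hS.nonneg
  have hy' : (4 : ℝ) ≤ y := by exact_mod_cast hy
  have hpos : (0 : ℝ) < y ^ 2 := by positivity
  refine le_of_mul_le_mul_right ?_ hpos
  obtain ⟨z, hz⟩ : ∃ z : ℝ, z = y - 4 := ⟨_, rfl⟩
  have hz0 : 0 ≤ z := by rw [hz]; linarith
  have hyz : (y : ℝ) = z + 4 := by rw [hz]; ring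
  have e1 : (0 : ℝ) ≤ (y - 3) ^ 3 * y ^ 2 := by rw [hyz]; ring_nf; positivity
  have e2 : (0 : ℝ) ≤ (3 * y ^ 2 - 15 * y + 19) * y := by rw [hyz]; ring_nf; positivity
  have e3 : (0 : ℝ) ≤ 6 * (y - 2) := by rw [hyz]; ring_nf; positivity
  have e4 : (0 : ℝ) ≤ y ^ 2 * (y - 3) * y ^ 2 - ((y - 3) ^ 3 * y ^ 2 +
      6 * ((3 * y ^ 2 - 15 * y + 19) * y) + 18 * (y - 2) + 20) := by
    rw [hyz]; ring_nf; positivity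
  have s1 := mul_le_mul_of_nonneg_left hS.total e1
  have s2 := mul_le_mul_of_nonneg_left
    (add_le_add (add_le_add (add_le_add (add_le_add (add_le_add p1 p2) p3) p4) p5) p6) e2
  have s3 := mul_le_mul_of_nonneg_left (add_le_add (add_le_add q1 q2) q3) e3
  have s4 := mul_nonneg e4 hK
  linarith

theorem card_cols_triple_le_prod :
    (cols y G (insert a (insert b (insert c T)))).card ≤
      ∑ f ∈ cols y G T, (avail G T f a).card * ((avail G T f b).card * (avail G T f c).card) := by
  have hsub : T ⊆ insert a (insert b (insert c T)) :=
    (subset_insert _ _).trans ((subset_insert _ _).trans (subset_insert _ _))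
  refine (card_cols_le_sum hsub (fun F => (F a, F b, F c))
    (fun f => avail G T f a ×ˢ avail G T f b ×ˢ avail G T f c) (fun F hF => ?_) ?_).trans
    (sum_le_sum fun f _ => by rw [card_product, card_product])
  · exact mem_product.2 ⟨mem_avail hF hsub (by simp), mem_product.2
      ⟨mem_avail hF hsub (by simp), mem_avail hF hsub (by simp)⟩⟩
  · intro F _ F' _ hE w hw hwT
    simp only [Prod.mk.injEq] at hE
    simp only [mem_insert, hwT, or_false] at hw
    rcases hw with rfl | rfl | rfl
    exacts [hE.1, hE.2.1, hE.2.2]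

theorem Spread.card_cols_triple_le (hS : Spread y G T K) (hy : 4 ≤ y) (ha : 4 ≤ deg G T a)
    (hb : 4 ≤ deg G T b) (hc : 4 ≤ deg G T c) :
    ((cols y G (insert a (insert b (insert c T)))).card : ℝ) ≤ y ^ 2 * (y - 3) * K := by
  have h := Nat.cast_le (α := ℝ).2 (card_cols_triple_le_prod (y := y) (G := G) (T := T)
    (a := a) (b := b) (c := c))
  push_cast at h
  refine h.trans ((sum_le_sum fun f _ => (mul_assoc _ _ _).symm.trans_le (mul_mul_le_sum_cubes
    (Nat.cast_nonneg _) (Nat.cast_nonneg _) (Nat.cast_nonneg _))).trans ?_)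
  rw [← sum_div, sum_add_distrib, sum_add_distrib]
  linarith [hS.sum_cube_card_avail_le hy ha, hS.sum_cube_card_avail_le hy hb,
    hS.sum_cube_card_avail_le hy hc]

theorem Frame.card_cols_le_of_independent (h : Frame y G T K a b c d e) (hy : 4 ≤ y)
    (hab : ¬ G.Adj a b) (hac : ¬ G.Adj a c) (hbc : ¬ G.Adj b c)
    (htri : ¬ ((G.Adj a d ∧ G.Adj a e) ∧ G.Adj d e)) :
    ((cols y G univ).card : ℝ) ≤ y ^ 4 * (y - 3) * K := by
  have hdeg : ∀ {a b c}, Frame y G T K a b c d e → ¬ G.Adj a b → ¬ G.Adj a c →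
      4 ≤ deg G (insert d (insert e T)) a := by
    intro a b c h hab hac
    have := h.four_le
    rw [if_neg hab, if_neg hac] at this
    rw [h.deg_insert_insert]
    omega
  have hconn : Conn G (insert d (insert e T)) := by
    have he4 := h.rotate.rotate.rotate.rotate.four_le
    have hd4 := h.rotate.rotate.rotate.four_le
    simp only [G.adj_comm e d, G.adj_comm d a, G.adj_comm e a] at he4 hd4
    rcases Nat.eq_zero_or_pos (deg G T d) with hd | hd <;>
      rcases Nat.eq_zero_or_pos (deg G T e) with he | he
    · split_ifs at hd4 he4 <;> first | omega | tauto
    · refine (h.conn.insert_deg he).insert_deg ?_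
      have hde : G.Adj d e := by
        by_contra hc
        rw [if_neg hc] at hd4
        split_ifs at hd4 <;> omega
      rw [deg_insert_of_adj h.rotate.rotate.rotate.rotate.notMem hde]
      omega
    · rw [insert_comm]
      refine (h.conn.insert_deg hd).insert_deg ?_
      have hde : G.Adj e d := by
        by_contra hc
        rw [if_neg fun h => hc (G.adj_symm h)] at he4
        split_ifs at he4 <;> omega
      rw [deg_insert_of_adj h.rotate.rotate.rotate.notMem hde]
      omega
    · exact h.conn₂ hd he
  have h1 := (h.spread₂ hconn).card_cols_triple_le hy (hdeg h hab hac)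
    (hdeg h.swap₁ (fun h => hab (G.adj_symm h)) hbc)
    (hdeg h.swap₂.swap₁ (fun h => hac (G.adj_symm h)) fun h => hbc (G.adj_symm h))
  rw [← h.univ_eq] at h1
  linarith

end FiveCrit

namespace FiveCrit

/-- A bound for `∑ c ∈ A, (edgeSet (B.erase c) C).card ^ 2` in terms of the sizes of the lists. -/
def cycleBound (y : ℕ) (a b c : ℝ) : ℝ :=
  (a + b - (y + 1)) * ((b - 2) * (c - 1) + y) ^ 2 + (y + 1 - b) * ((b - 1) * (c - 1) + y) ^ 2

theorem sum_card_edgeSet_sq_le {y : ℕ} {A B C : Finset (Fin (y + 1))} {a b c : ℕ}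
    (hA : A.card ≤ a) (hB : B.card ≤ b) (hC : C.card ≤ c) (ha : a ≤ y + 1) (hb : b ≤ y + 1)
    (hb2 : 2 ≤ b) (hc1 : 1 ≤ c) :
    ∑ x ∈ A, ((edgeSet (B.erase x) C).card : ℝ) ^ 2 ≤ cycleBound y a b c := by
  obtain ⟨A', hAA, hA'⟩ := exists_superset_of_card_le hA ha
  obtain ⟨B', hBB, hB'⟩ := exists_superset_of_card_le hB hb
  have hle : ∀ x ∈ A, ((edgeSet (B.erase x) C).card : ℝ) ^ 2 ≤
      if x ∈ B' then (((b : ℝ) - 2) * (c - 1) + y) ^ 2 else (((b : ℝ) - 1) * (c - 1) + y) ^ 2 := by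
    intro x _
    split_ifs with hx
    · have hcard : (B.erase x).card ≤ b - 1 :=
        (card_le_card (erase_subset_erase x hBB)).trans_eq (by rw [card_erase_of_mem hx, hB'])
      have := card_edgeSet_le hcard hC (by omega) hc1
      push_cast [Nat.cast_sub (show 1 ≤ b by omega)] at this
      exact pow_le_pow_left₀ (Nat.cast_nonneg _) (by linarith) 2
    · exact pow_le_pow_left₀ (Nat.cast_nonneg _)
        (card_edgeSet_le ((card_erase_le).trans hB) hC (by omega) hc1) 2
  refine (sum_le_sum hle).trans ((sum_le_sum_of_subset_of_nonneg hAA fun _ _ _ => by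
    split_ifs <;> positivity).trans ?_)
  rw [sum_ite, sum_const, sum_const, nsmul_eq_mul, nsmul_eq_mul]
  have h1 := card_inter_ge A' B'
  have h2 : ((A'.filter (· ∈ B')).card : ℝ) + (A'.filter (· ∉ B')).card = a := by
    rw [← hA', ← card_filter_add_card_filter_not (s := A') (· ∈ B')]
    push_cast
    rfl
  rw [filter_mem_eq_inter] at h2 ⊢
  rw [hA', hB'] at h1
  have hb2' : (2 : ℝ) ≤ b := by exact_mod_cast hb2
  have hc1' : (1 : ℝ) ≤ c := by exact_mod_cast hc1
  have hsq : (((b : ℝ) - 2) * (c - 1) + y) ^ 2 ≤ (((b : ℝ) - 1) * (c - 1) + y) ^ 2 :=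
    pow_le_pow_left₀ (by have := mul_nonneg (sub_nonneg.2 hb2') (sub_nonneg.2 hc1'); positivity)
      (by nlinarith) 2
  rw [← eq_sub_iff_add_eq'] at h2
  rw [h2, cycleBound]
  nlinarith [mul_nonneg (sub_nonneg.2 h1) (sub_nonneg.2 hsq)]

theorem cycleBound_le {y : ℕ} (hy : 4 ≤ y) {i j k : ℕ} (hi : i = 0 ∨ i = 1) (hj : j = 0 ∨ j = 1)
    (hk : k = 0 ∨ k = 1) :
    cycleBound y ((y - 1 + i : ℕ)) ((y - 1 + j : ℕ)) ((y - 1 + k : ℕ)) ≤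
      cycleBound y (y - 1) (y - 1) (y - 1) + (cycleBound y y y y - cycleBound y (y - 1) y y) * i +
        (cycleBound y (y - 1) y y - cycleBound y (y - 1) (y - 1) y) * j +
        (cycleBound y (y - 1) (y - 1) y - cycleBound y (y - 1) (y - 1) (y - 1)) * k := by
  have hy' : (4 : ℝ) ≤ y := by exact_mod_cast hy
  obtain ⟨z, hz⟩ : ∃ z : ℝ, z = y - 4 := ⟨_, rfl⟩
  have hz0 : 0 ≤ z := by rw [hz]; linarith
  have hyz : (y : ℝ) = z + 4 := by rw [hz]; ring
  push_cast [Nat.cast_sub (show 1 ≤ y by omega)]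
  rw [← sub_nonneg]
  unfold cycleBound
  rw [hyz]
  rcases hi with rfl | rfl <;> rcases hj with rfl | rfl <;> rcases hk with rfl | rfl <;>
    push_cast <;> ring_nf <;> positivity

variable {V : Type} [Fintype V] {y : ℕ} {G : SimpleGraph V} {T : Finset V} {K : ℝ}
  {a b c d e : V}

theorem card_cols_cycle_le (hab : G.Adj a b) (hbc : G.Adj b c) (hcd : G.Adj c d) (hde : G.Adj d e)
    (hea : G.Adj e a) :
    (cols y G (insert a (insert b (insert c (insert d (insert e T)))))).card ≤
      ∑ f ∈ cols y G T, ∑ x ∈ avail G T f a,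
        (edgeSet ((avail G T f b).erase x) (avail G T f c)).card *
          (edgeSet ((avail G T f e).erase x) (avail G T f d)).card := by
  have hsub : T ⊆ insert a (insert b (insert c (insert d (insert e T)))) := by
    intro x hx
    simp [hx]
  refine (card_cols_le_sum hsub
    (fun F => (⟨F a, (F b, F c), (F e, F d)⟩ :
      Σ _ : Fin (y + 1), (Fin (y + 1) × Fin (y + 1)) × (Fin (y + 1) × Fin (y + 1))))
    (fun f => (avail G T f a).sigma fun x =>
      edgeSet ((avail G T f b).erase x) (avail G T f c) ×ˢ
        edgeSet ((avail G T f e).erase x) (avail G T f d)) (fun F hF => ?_) ?_).trans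
    (sum_le_sum fun f _ => by simp only [card_sigma, card_product, le_refl])
  · have hp := (mem_cols.1 hF).2
    have hm : ∀ v ∈ insert a (insert b (insert c (insert d (insert e T)))), _ :=
      fun v hv => mem_avail hF hsub hv
    simp only [mem_sigma, mem_product, edgeSet, mem_filter, mem_erase]
    exact ⟨hm a (by simp), ⟨⟨⟨hp b (by simp) a (by simp) hab.symm, hm b (by simp)⟩, hm c (by simp)⟩,
      hp b (by simp) c (by simp) hbc⟩, ⟨⟨hp e (by simp) a (by simp) hea, hm e (by simp)⟩,
      hm d (by simp)⟩, hp e (by simp) d (by simp) hde.symm⟩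
  · intro F _ F' _ hE w hw hwT
    simp only [Sigma.mk.injEq, heq_eq_eq, Prod.mk.injEq] at hE
    simp only [mem_insert, hwT, or_false] at hw
    rcases hw with rfl | rfl | rfl | rfl | rfl
    exacts [hE.1, hE.2.1.1, hE.2.1.2, hE.2.2.2, hE.2.2.1]

theorem Frame.card_cols_le_of_cycle (h : Frame y G T K a b c d e) (hy : 4 ≤ y) (hab : G.Adj a b)
    (hbc : G.Adj b c) (hcd : G.Adj c d) (hde : G.Adj d e) (hea : G.Adj e a) (hac : ¬ G.Adj a c)
    (had : ¬ G.Adj a d) (hbd : ¬ G.Adj b d) (hbe : ¬ G.Adj b e) (hce : ¬ G.Adj c e) :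
    ((cols y G univ).card : ℝ) ≤ y ^ 4 * (y - 3) * K := by
  have hdeg : ∀ {a b c d e}, Frame y G T K a b c d e → ¬ G.Adj a c → ¬ G.Adj a d →
      2 ≤ deg G T a := by
    intro a b c d e h hac had
    have := h.four_le
    rw [if_neg hac, if_neg had] at this
    split_ifs at this <;> omega
  have hsymm : ∀ {u v}, ¬ G.Adj u v → ¬ G.Adj v u := fun h h' => h (G.adj_symm h')
  obtain ⟨ε₁, h1, l1, s1⟩ := h.spread₀.excess (by omega) (hdeg h hac had)
  obtain ⟨ε₂, h2, l2, s2⟩ := h.spread₀.excess (by omega) (hdeg h.rotate hbd hbe)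
  obtain ⟨ε₃, h3, l3, s3⟩ := h.spread₀.excess (by omega) (hdeg h.rotate.rotate hce (hsymm hac))
  obtain ⟨ε₄, h4, l4, s4⟩ := h.spread₀.excess (by omega)
    (hdeg h.rotate.rotate.rotate (hsymm had) (hsymm hbd))
  obtain ⟨ε₅, h5, l5, s5⟩ := h.spread₀.excess (by omega)
    (hdeg h.rotate.rotate.rotate.rotate (hsymm hbe) (hsymm hce))
  have hcast := Nat.cast_le (α := ℝ).2
    (card_cols_cycle_le (y := y) (T := T) hab hbc hcd hde hea)
  rw [← h.univ_eq] at hcast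
  push_cast at hcast
  have hle : ∀ f ∈ cols y G T, ∑ x ∈ avail G T f a,
        ((edgeSet ((avail G T f b).erase x) (avail G T f c)).card : ℝ) *
          (edgeSet ((avail G T f e).erase x) (avail G T f d)).card ≤
      cycleBound y (y - 1) (y - 1) (y - 1) +
        (cycleBound y y y y - cycleBound y (y - 1) y y) * ε₁ f +
        (cycleBound y (y - 1) y y - cycleBound y (y - 1) (y - 1) y) / 2 * (ε₂ f + ε₅ f) +
        (cycleBound y (y - 1) (y - 1) y - cycleBound y (y - 1) (y - 1) (y - 1)) / 2 *
          (ε₃ f + ε₄ f) := by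
    intro f hf
    have hle : ∀ n : ℕ, n = 0 ∨ n = 1 → n ≤ 1 := by omega
    have e1 := hle _ (h1 f)
    have e2 := hle _ (h2 f)
    have e3 := hle _ (h3 f)
    have e4 := hle _ (h4 f)
    have e5 := hle _ (h5 f)
    have w1 := (sum_card_edgeSet_sq_le (l1 f hf) (l2 f hf) (l3 f hf) (by omega) (by omega)
      (by omega) (by omega)).trans (cycleBound_le hy (h1 f) (h2 f) (h3 f))
    have w2 := (sum_card_edgeSet_sq_le (l1 f hf) (l5 f hf) (l4 f hf) (by omega) (by omega)
      (by omega) (by omega)).trans (cycleBound_le hy (h1 f) (h5 f) (h4 f))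
    have w3 := sum_le_sum fun x (_ : x ∈ avail G T f a) => two_mul_le_add_sq
      ((edgeSet ((avail G T f b).erase x) (avail G T f c)).card : ℝ)
      (edgeSet ((avail G T f e).erase x) (avail G T f d)).card
    simp only [mul_assoc, ← mul_sum] at w3
    rw [sum_add_distrib] at w3
    linarith
  refine hcast.trans ((sum_le_sum hle).trans ?_)
  simp only [sum_add_distrib, ← mul_sum, sum_const, nsmul_eq_mul]
  have hK := h.spread₀.nonneg
  have hy' : (4 : ℝ) ≤ y := by exact_mod_cast hy
  have hpos : (0 : ℝ) < y := by linarith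
  rw [le_div_iff₀ hpos] at s1 s2 s3 s4 s5
  refine le_of_mul_le_mul_right ?_ hpos
  obtain ⟨z, hz⟩ : ∃ z : ℝ, z = y - 4 := ⟨_, rfl⟩
  have hz0 : 0 ≤ z := by rw [hz]; linarith
  have hyz : (y : ℝ) = z + 4 := by rw [hz]; ring
  have p0 : 0 ≤ cycleBound y (y - 1) (y - 1) (y - 1) * y := by
    unfold cycleBound; rw [hyz]; ring_nf; positivity
  have p1 : 0 ≤ cycleBound y y y y - cycleBound y (y - 1) y y := by
    unfold cycleBound; rw [hyz]; ring_nf; positivity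
  have p2 : 0 ≤ (cycleBound y (y - 1) y y - cycleBound y (y - 1) (y - 1) y) / 2 := by
    unfold cycleBound; rw [hyz]; ring_nf; positivity
  have p3 : 0 ≤ (cycleBound y (y - 1) (y - 1) y - cycleBound y (y - 1) (y - 1) (y - 1)) / 2 := by
    unfold cycleBound; rw [hyz]; ring_nf; positivity
  have p4 : 0 ≤ y ^ 4 * (y - 3) * y - (cycleBound y (y - 1) (y - 1) (y - 1) * y +
      (cycleBound y y y y - cycleBound y (y - 1) (y - 1) (y - 1))) := by
    unfold cycleBound; rw [hyz]; ring_nf; positivity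
  linarith [mul_le_mul_of_nonneg_left h.spread₀.total p0, mul_le_mul_of_nonneg_left s1 p1,
    mul_le_mul_of_nonneg_left (add_le_add s2 s5) p2,
    mul_le_mul_of_nonneg_left (add_le_add s3 s4) p3, mul_nonneg p4 hK]

end FiveCrit

namespace FiveCrit

theorem col_of_colorable_induce {V : Type} {G : SimpleGraph V} {k : ℕ} [NeZero k] {S : Set V}
    {W : Finset V} (hW : ∀ v ∈ W, v ∈ S) (h : (G.induce S).Colorable k) : Col k G W := by
  obtain ⟨C⟩ := h
  refine ⟨fun v => if hv : v ∈ S then C ⟨v, hv⟩ else 0, fun u hu v hv huv => ?_⟩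
  simp only [hW u hu, hW v hv, dif_pos]
  exact C.valid huv

theorem colorable_induce_of_col {V : Type} {G : SimpleGraph V} {k : ℕ} {S : Set V}
    {W : Finset V} (hW : ∀ v ∈ S, v ∈ W) (h : Col k G W) : (G.induce S).Colorable k := by
  obtain ⟨f, hf⟩ := h
  exact ⟨SimpleGraph.Coloring.mk (fun v => f v) fun {u v} huv =>
    hf u (hW u u.2) v (hW v v.2) huv⟩

variable {V : Type} [Fintype V] {y : ℕ} {G : SimpleGraph V} {T : Finset V} {K : ℝ}
  {a b c d e : V}

theorem numColorings_eq_card_cols : numColorings G (y + 1) = (cols y G univ).card := by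
  rw [numColorings, Nat.card_eq_fintype_card, Fintype.card_subtype]
  congr 1
  ext f
  simp [mem_cols, ProperOn]

theorem crit_univ (h : FiveCritical G) : Crit 4 G univ := by
  refine ⟨fun hcol => ?_, fun v _ => ?_⟩
  · obtain ⟨f, hf⟩ := hcol
    have : G.Colorable 4 :=
      ⟨SimpleGraph.Coloring.mk f fun {u v} huv => hf u (mem_univ _) v (mem_univ _) huv⟩
    have := this.chromaticNumber_le
    rw [h.1] at this
    exact absurd this (by decide)
  · exact col_of_colorable_induce (S := {u : V | u ≠ v}) (fun u hu => (mem_erase.1 hu).1)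
      (SimpleGraph.chromaticNumber_le_iff_colorable.1 (h.2 v).le)

/-- Five vertices span a triangle, an independent set of size three, or a cycle. -/
theorem Frame.card_cols_le (h : Frame y G T K a b c d e) (hy : 4 ≤ y) :
    ((cols y G univ).card : ℝ) ≤ y ^ 4 * (y - 3) * K := by
  by_contra hlt
  have tri : ∀ {a b c d e}, Frame y G T K a b c d e → G.Adj a b → G.Adj a c → ¬ G.Adj b c :=
    fun h hab hac hbc => hlt (h.card_cols_le_of_triangle hy hab hac hbc)
  have ind : ∀ {a b c d e}, Frame y G T K a b c d e → ¬ G.Adj a b → ¬ G.Adj a c → G.Adj b c := by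
    intro a b c d e h hab hac
    by_contra hbc
    exact hlt (h.card_cols_le_of_independent hy hab hac hbc
      fun h' => tri h.swap₃.swap₂.swap₁.swap₄.swap₃ h'.1.1.symm h'.2 h'.1.2)
  have key : ∀ {a b c d e}, Frame y G T K a b c d e → G.Adj a b → ¬ G.Adj a c := by
    intro a b c d e h hab hac
    have hbc := tri h hab hac
    have had : ¬ G.Adj a d := fun had =>
      tri h.swap₂.swap₃ hac had (ind h.rotate hbc (tri h.swap₃ hab had))
    have hae : ¬ G.Adj a e := fun hae =>
      tri h.swap₂.swap₄.swap₃ hac hae (ind h.rotate.swap₃ hbc (tri h.swap₄.swap₃ hab hae))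
    have hde := ind h.swap₃.swap₂.swap₄.swap₃ had hae
    have hcy : ∀ {b c}, Frame y G T K a b c d e → G.Adj a b → G.Adj a c → ¬ G.Adj b c →
        ¬ G.Adj b d := by
      intro b c h hab hac hbc hbd
      have hbe : ¬ G.Adj b e := fun hbe => tri h.rotate.swap₂.swap₃ hbd hbe hde
      have hce := ind h.rotate.swap₃ hbc hbe
      have hcd : ¬ G.Adj c d := fun hcd => tri h.rotate.rotate hcd hce hde
      exact hlt (h.swap₃.swap₄.card_cols_le_of_cycle hy hab hbd hde hce.symm hac.symm had hae hbe
        hbc fun h => hcd (G.adj_symm h))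
    exact hcy h.swap₂ hac hab (fun h => hbc (G.adj_symm h)) (ind h.rotate hbc (hcy h hab hac hbc))
  have hnot : ∀ {a b c d e}, Frame y G T K a b c d e → ¬ G.Adj a b := by
    intro a b c d e h hab
    have hac := key h hab
    have had := key h.swap₃ hab
    have hae := key h.swap₄.swap₃ hab
    exact key h.rotate.rotate (ind h.swap₂.swap₃ hac had) (ind h.swap₂.swap₄.swap₃ hac hae)
  exact hnot h.rotate (ind h (hnot h) (hnot h.swap₂))

theorem exists_frame (hy : 4 ≤ y) (h : Crit 4 G univ) (hT : Conn G T) (hcol : ¬ Col 3 G T)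
    (hcard : (univ \ T).card = 5) :
    ∃ a b c d e, Frame y G T ((y + 1) * (y - 1) * (y - 2) / y ^ 3 * y ^ T.card) a b c d e := by
  have hlen : (univ \ T).toList.length = 5 := by rw [length_toList, hcard]
  obtain ⟨a, b, c, d, e, hl⟩ : ∃ a b c d e, (univ \ T).toList = [a, b, c, d, e] := by
    generalize (univ \ T).toList = l at hlen
    match l, hlen with
    | [a, b, c, d, e], _ => exact ⟨a, b, c, d, e, rfl⟩
  refine ⟨a, b, c, d, e, hl ▸ nodup_toList _, fun x => ?_, fun x _ => h.le_deg (mem_univ x), hT,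
    fun U n hTU hn hU => ?_⟩
  · rw [← hl, mem_toList]
    simp
  · have hy' : (4 : ℝ) ≤ y := by exact_mod_cast hy
    have hκ : (0 : ℝ) ≤ (y + 1) * (y - 1) * (y - 2) / y ^ 3 := by
      refine div_nonneg (mul_nonneg (mul_nonneg ?_ ?_) ?_) (by positivity) <;> linarith
    have := (good_not_col_three hy).spread (homClosed_not_col 3) hκ hU fun hc => hcol (hc.mono hTU)
    rwa [hn, pow_add, ← mul_assoc] at this

theorem exists_conn_of_chromaticNumber (h : Crit 4 G univ) {S : Set V} (hS : 5 ≤ S.ncard)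
    (hchrom : 4 ≤ (G.induce Sᶜ).chromaticNumber) :
    ∃ T, Conn G T ∧ ¬ Col 3 G T ∧ (univ \ T).card = 5 := by
  have hcol : ¬ Col 3 G (Sᶜ).toFinset := fun hc => by
    have h3 := (colorable_induce_of_col (S := Sᶜ) (by simp) hc).chromaticNumber_le
    exact absurd (hchrom.trans h3) (by decide)
  obtain ⟨U, hU, hUc⟩ := exists_crit hcol
  have hSU : S.toFinset ⊆ univ \ U := by
    intro x hx
    rw [mem_sdiff]
    refine ⟨mem_univ _, fun hxU => ?_⟩
    have := hU hxU
    simp only [Set.mem_toFinset, Set.mem_compl_iff] at this hx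
    exact this hx
  have hcard : 5 ≤ (univ \ U).card := by
    rw [Set.ncard_eq_toFinset_card'] at hS
    exact hS.trans (card_le_card hSU)
  obtain ⟨T, hUT, -, hT, hTc⟩ := h.conn.grow hUc.conn (subset_univ _) 5 hcard
  exact ⟨T, hT, fun hc => hUc.1 (hc.mono hUT), hTc⟩

end FiveCrit

end

/-- If `G` is a `5`-critical graph on `n` vertices and there is a vertex set `S` with
`|S| ≥ 5` such that `G - S` has chromatic number at least `4`, then for every integer
`y ≥ 4` we have `Q_G(y) ≤ (y+1)·y^(n-4)·(y-1)·(y-2)·(y-3)`. -/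
theorem five_critical_deletion_bound {V : Type} [Fintype V] (G : SimpleGraph V)
    (hcrit : FiveCritical G) (S : Set V) (hS : 5 ≤ S.ncard)
    (hchrom : 4 ≤ (G.induce Sᶜ).chromaticNumber)
    (y : ℕ) (hy : 4 ≤ y) :
    numColorings G (y + 1) ≤
      (y + 1) * y ^ (Fintype.card V - 4) * (y - 1) * (y - 2) * (y - 3) := by
  classical
  have hc := FiveCrit.crit_univ hcrit
  obtain ⟨T, hT, hcol, hcard⟩ := FiveCrit.exists_conn_of_chromaticNumber hc hS hchrom
  obtain ⟨a, b, c, d, e, h⟩ := FiveCrit.exists_frame hy hc hT hcol hcard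
  have hn : Fintype.card V - 4 = T.card + 1 := by
    rw [Finset.card_sdiff_of_subset (Finset.subset_univ _), Finset.card_univ] at hcard
    omega
  have hy0 : (y : ℝ) ≠ 0 := by
    have : y ≠ 0 := by omega
    exact_mod_cast this
  rw [FiveCrit.numColorings_eq_card_cols, hn, ← Nat.cast_le (α := ℝ)]
  refine (h.card_cols_le hy).trans (le_of_eq ?_)
  push_cast [Nat.cast_sub (show 1 ≤ y by omega), Nat.cast_sub (show 2 ≤ y by omega),
    Nat.cast_sub (show 3 ≤ y by omega)]
  field_simp
  ring
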